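/- arXiv:2403.20238 — 8 statements merged into one kernel-verified Lean document; each statement's English description precedes it below -/
import Mathlib

section
/- If A has full column rank, then for every compact set K ⊆ ℝ^e × ℝ there exists d > 0 such that for all (φ, ε) ∈ K and all v ∈ ℝ^e one has vᵀ·D²_{φφ}Φ(φ, ε)·v ≥ d·‖v‖²; in particular, φ ↦ Φ(φ, ε) is uniformly (strongly) convex on compact domains. -/
open Matrix

/-- A matrix whose rank is its number of columns acts injectively on vectors. -/
lemma Matrix.mulVec_injective_of_rank_eq {m e : ℕ} (A : Matrix (Fin m) (Fin e) ℝ)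
    (hrank : A.rank = e) : Function.Injective A.mulVec := by
  rw [Matrix.mulVec_injective_iff, linearIndependent_iff_card_eq_finrank_span,
    Set.finrank, ← Matrix.rank_eq_finrank_span_cols, hrank, Fintype.card_fin]

lemma isCompact_setOf_sum_sq_eq_one {ι : Type*} [Fintype ι] :
    IsCompact {v : ι → ℝ | ∑ j, v j ^ 2 = 1} := by
  refine Metric.isCompact_of_isClosed_isBounded
    (isClosed_eq (by fun_prop) continuous_const) ?_
  refine (Metric.isBounded_closedBall (x := (0 : ι → ℝ)) (r := 1)).subset fun v hv => ?_
  rw [mem_closedBall_zero_iff, pi_norm_le_iff_of_nonneg zero_le_one]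
  intro i
  rw [Real.norm_eq_abs, ← sq_le_one_iff_abs_le_one]
  exact (Finset.single_le_sum (f := fun j => v j ^ 2) (fun j _ => sq_nonneg _)
    (Finset.mem_univ i)).trans_eq hv

/-- A continuous family of functions, each homogeneous of degree two and positive away from the
origin, is bounded below by a positive multiple of `‖v‖²` over a compact parameter set. -/
lemma IsCompact.exists_pos_mul_sum_sq_le {X ι : Type*} [TopologicalSpace X] [Fintype ι]
    {K : Set X} (hK : IsCompact K) (Q : X → (ι → ℝ) → ℝ)
    (hQ : Continuous fun q : X × (ι → ℝ) => Q q.1 q.2)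
    (hsmul : ∀ p (r : ℝ) v, Q p (r • v) = r ^ 2 * Q p v)
    (hpos : ∀ p v, v ≠ 0 → 0 < Q p v) :
    ∃ d > 0, ∀ p ∈ K, ∀ v : ι → ℝ, d * ∑ j, v j ^ 2 ≤ Q p v := by
  obtain ⟨d, hd, h⟩ := (hK.prod (isCompact_setOf_sum_sq_eq_one (ι := ι))).exists_forall_le'
    hQ.continuousOn (a := 0) (by
      rintro ⟨p, v⟩ ⟨-, hv⟩
      refine hpos p v ?_
      rintro rfl
      simp at hv)
  refine ⟨d, hd, fun p hp v => ?_⟩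
  have hs : 0 ≤ ∑ j, v j ^ 2 := Finset.sum_nonneg fun j _ => sq_nonneg _
  rcases hs.eq_or_lt with h0 | h0
  · rw [← h0, mul_zero]
    rcases eq_or_ne v 0 with rfl | hv
    · simpa using (hsmul p 0 0).ge
    · exact (hpos p v hv).le
  · set s := ∑ j, v j ^ 2 with hs_def
    have hsq : (√s)⁻¹ ^ 2 = s⁻¹ := by rw [inv_pow, Real.sq_sqrt hs]
    have h1 := h (p, (√s)⁻¹ • v) ⟨hp, by
      simp only [Set.mem_ofPred_eq, Pi.smul_apply, smul_eq_mul, mul_pow, ← Finset.mul_sum, hsq]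
      rw [← hs_def, inv_mul_cancel₀ h0.ne']⟩
    simp only [hsmul, hsq] at h1
    rwa [inv_mul_eq_div, le_div_iff₀ h0] at h1

section SumExpHessian

variable {m e : ℕ} (η : ℝ) (A : Matrix (Fin m) (Fin e) ℝ) (c μ : Fin m → ℝ) (ε : ℝ)

lemma hasFDerivAt_exp_affine (φ : Fin e → ℝ) (ℓ : Fin m) :
    HasFDerivAt (fun ψ : Fin e → ℝ => Real.exp ((∑ j, A ℓ j * ψ j - ε * c ℓ) / η))
      (Real.exp ((∑ j, A ℓ j * φ j - ε * c ℓ) / η) •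
        η⁻¹ • ∑ j, A ℓ j • (ContinuousLinearMap.proj j : (Fin e → ℝ) →L[ℝ] ℝ)) φ := by
  refine HasFDerivAt.exp ?_
  simp only [div_eq_mul_inv]
  refine HasFDerivAt.mul_const (HasFDerivAt.sub_const _ ?_) _
  exact HasFDerivAt.fun_sum fun j _ => (hasFDerivAt_apply j φ).const_mul (A ℓ j)

lemma fderiv_linear_add_sum_exp_apply (hη : η ≠ 0) (b φ v : Fin e → ℝ) :
    fderiv ℝ (fun ψ : Fin e → ℝ => -(∑ j, b j * ψ j) +
      η * ∑ ℓ, Real.exp ((∑ j, A ℓ j * ψ j - ε * c ℓ) / η) * μ ℓ) φ v =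
    -(∑ j, b j * v j) +
      ∑ ℓ, Real.exp ((∑ j, A ℓ j * φ j - ε * c ℓ) / η) * (μ ℓ * (A *ᵥ v) ℓ) := by
  have h := (HasFDerivAt.fun_sum (u := Finset.univ) fun j _ =>
      (hasFDerivAt_apply (𝕜 := ℝ) j φ).const_mul (b j)).neg.add
    ((HasFDerivAt.fun_sum (u := Finset.univ) fun ℓ _ =>
      (hasFDerivAt_exp_affine η A c ε φ ℓ).mul_const (μ ℓ)).const_mul η)
  refine (congrArg (· v) h.fderiv).trans ?_
  simp only [_root_.add_apply, _root_.neg_apply, _root_.sum_apply, _root_.smul_apply,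
    ContinuousLinearMap.proj_apply,
    smul_eq_mul, Finset.mul_sum, Matrix.mulVec, dotProduct]
  congr 1
  refine Finset.sum_congr rfl fun ℓ _ => Finset.sum_congr rfl fun j _ => ?_
  field_simp

lemma fderiv_fderiv_linear_add_sum_exp_apply (hη : η ≠ 0) (b φ v : Fin e → ℝ) :
    fderiv ℝ (fun ψ : Fin e → ℝ => fderiv ℝ (fun ψ' : Fin e → ℝ => -(∑ j, b j * ψ' j) +
      η * ∑ ℓ, Real.exp ((∑ j, A ℓ j * ψ' j - ε * c ℓ) / η) * μ ℓ) ψ v) φ v =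
    ∑ ℓ, Real.exp ((∑ j, A ℓ j * φ j - ε * c ℓ) / η) * (μ ℓ / η * (A *ᵥ v) ℓ ^ 2) := by
  simp only [fderiv_linear_add_sum_exp_apply η A c μ ε hη]
  have h := (HasFDerivAt.fun_sum (u := Finset.univ) fun ℓ _ =>
      (hasFDerivAt_exp_affine η A c ε φ ℓ).mul_const (μ ℓ * (A *ᵥ v) ℓ)).const_add
      (-(∑ j, b j * v j))
  refine (congrArg (· v) h.fderiv).trans ?_
  simp only [_root_.sum_apply, _root_.smul_apply,
    ContinuousLinearMap.proj_apply, smul_eq_mul]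
  refine Finset.sum_congr rfl fun ℓ _ => ?_
  rw [show ∑ j, A ℓ j * v j = (A *ᵥ v) ℓ from rfl]
  ring

end SumExpHessian

/-- If `A` has full column rank, then on every compact set `K` there is `d > 0` such that the
Hessian of `Φ(·, ε)` at every `(φ, ε) ∈ K` satisfies `vᵀ D²Φ v ≥ d‖v‖²` (uniform strong
convexity of `φ ↦ Φ(φ, ε)` on compact domains). -/
theorem stmt_1
    (η : ℝ) (hη : 0 < η) (m e : ℕ) (hm : 0 < m) (he : 0 < e)
    (A : Matrix (Fin m) (Fin e) ℝ) (b : Fin e → ℝ) (c : Fin m → ℝ)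
    (μ : Fin m → ℝ) (hμ : ∀ ℓ, 0 < μ ℓ)
    (Φ : (Fin e → ℝ) → ℝ → ℝ)
    (hΦ : ∀ φ ε, Φ φ ε =
      -(∑ j, b j * φ j) + η * ∑ ℓ, Real.exp ((∑ j, A ℓ j * φ j - ε * c ℓ) / η) * μ ℓ)
    (hrank : A.rank = e) :
    ∀ K : Set ((Fin e → ℝ) × ℝ), IsCompact K →
      ∃ d > 0, ∀ p ∈ K, ∀ v : Fin e → ℝ,
        d * ∑ j, v j ^ 2 ≤
          fderiv ℝ (fun ψ => fderiv ℝ (fun ψ' => Φ ψ' p.2) ψ v) p.1 v := by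
  intro K hK
  simp only [hΦ, fderiv_fderiv_linear_add_sum_exp_apply η A c μ _ hη.ne' b]
  refine hK.exists_pos_mul_sum_sq_le (fun p v => ∑ ℓ,
    Real.exp ((∑ j, A ℓ j * p.1 j - p.2 * c ℓ) / η) * (μ ℓ / η * (A *ᵥ v) ℓ ^ 2)) ?_ ?_ ?_
  · simp only [Matrix.mulVec, dotProduct]
    fun_prop
  · intro p r v
    simp only [Matrix.mulVec_smul, Pi.smul_apply, smul_eq_mul, Finset.mul_sum]
    exact Finset.sum_congr rfl fun ℓ _ => by ring
  · intro p v hv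
    have hAv : A *ᵥ v ≠ 0 := fun h =>
      hv (A.mulVec_injective_of_rank_eq hrank (h.trans (A.mulVec_zero).symm))
    obtain ⟨ℓ, hℓ⟩ := Function.ne_iff.mp hAv
    have hw : ∀ k, 0 < μ k / η := fun k => div_pos (hμ k) hη
    refine Finset.sum_pos' (fun k _ => ?_) ⟨ℓ, Finset.mem_univ ℓ, ?_⟩
    · have := hw k
      positivity
    · have := hw ℓ
      have := sq_pos_of_ne_zero hℓ
      positivity
end

section
/- Suppose A has full column rank and ∇_φΦ(φ₀, ε₀) = 0 for some φ₀ ∈ ℝ^e, ε₀ ∈ ℝ. Then there exist δ > 0 and a continuously differentiable function φ : (ε₀ − δ, ε₀ + δ) → ℝ^e with φ(ε₀) = φ₀ such that ∇_φΦ(φ(ε), ε) = 0 for all ε, and φ satisfies the ODE φ'(ε) = −[D²_{φφ}Φ(φ(ε), ε)]⁻¹ · ∂_ε∇_φΦ(φ(ε), ε). -/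
open Matrix

namespace Matrix

/-- If `A` has linearly independent columns and `w` is positive, then `Aᵀ diag(w) A` is positive
definite. -/
theorem posDef_transpose_mul_diagonal_mul_self {m n : Type*} [Fintype m] [Fintype n]
    [DecidableEq m] {A : Matrix m n ℝ} (hA : A.rank = Fintype.card n) {w : m → ℝ}
    (hw : ∀ i, 0 < w i) : (Aᵀ * diagonal w * A).PosDef := by
  have hinj : Function.Injective A.mulVec := by
    rw [mulVec_injective_iff, linearIndependent_iff_card_eq_finrank_span, Set.finrank,
      ← rank_eq_finrank_span_cols,
      hA]
  simpa using (PosDef.diagonal hw).conjTranspose_mul_mul_same hinj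

end Matrix

/-- The implicit function theorem for a `C¹` map `g : ℝ × ℝⁿ → ℝⁿ` whose partial derivative in the
second variable is given by an invertible matrix: the zero set of `g` is locally a `C¹` curve,
which solves the associated ordinary differential equation. -/
theorem exists_contDiffOn_curve_of_isUnit {n : Type*} [Fintype n] [DecidableEq n]
    {g : ℝ × (n → ℝ) → (n → ℝ)} {M : ℝ × (n → ℝ) → Matrix n n ℝ} {v : ℝ × (n → ℝ) → (n → ℝ)}
    (hg : ContDiff ℝ 1 g) (hM : ∀ p, IsUnit (M p))
    (hd : ∀ p, HasFDerivAt g ((ContinuousLinearMap.fst ℝ ℝ (n → ℝ)).smulRight (v p) +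
      (M p).mulVecLin.toContinuousLinearMap ∘L ContinuousLinearMap.snd ℝ ℝ (n → ℝ)) p)
    {t₀ : ℝ} {x₀ : n → ℝ} (h₀ : g (t₀, x₀) = 0) :
    ∃ δ > 0, ∃ x : ℝ → (n → ℝ), x t₀ = x₀ ∧
      ContDiffOn ℝ 1 x (Set.Ioo (t₀ - δ) (t₀ + δ)) ∧
      ∀ t ∈ Set.Ioo (t₀ - δ) (t₀ + δ),
        g (t, x t) = 0 ∧ HasDerivAt x (-((M (t, x t))⁻¹ *ᵥ v (t, x t))) t := by
  have hinv : (fderiv ℝ g (t₀, x₀) ∘L .inr ℝ ℝ (n → ℝ)).IsInvertible := by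
    have heq : fderiv ℝ g (t₀, x₀) ∘L .inr ℝ ℝ (n → ℝ) =
        (M (t₀, x₀)).mulVecLin.toContinuousLinearMap := by
      ext1 y
      simp [(hd (t₀, x₀)).fderiv]
    have hdet := (Matrix.isUnit_iff_isUnit_det _).1 (hM (t₀, x₀))
    rw [heq]
    exact ⟨(Matrix.toLin'OfInv (Matrix.nonsing_inv_mul _ hdet)
      (Matrix.mul_nonsing_inv _ hdet)).toContinuousLinearEquiv, by
        ext1 y; simp [Matrix.toLin'OfInv]⟩
  have hc : ContDiffAt ℝ 1 g (t₀, x₀) := hg.contDiffAt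
  set x := hc.implicitFunction one_ne_zero hinv
  have hx : ∀ᶠ t in nhds t₀, ContDiffAt ℝ 1 x t ∧ g (t, x t) = 0 := by
    refine ((hc.contDiffAt_implicitFunction one_ne_zero hinv).eventually (by simp)).and ?_
    simpa only [h₀] using hc.eventually_apply_implicitFunction one_ne_zero hinv
  obtain ⟨δ, hδ, hball⟩ := Metric.eventually_nhds_iff_ball.1 hx
  rw [Real.ball_eq_Ioo] at hball
  refine ⟨δ, hδ, x, hc.implicitFunction_apply_self one_ne_zero hinv,
    fun t ht => (hball t ht).1.contDiffWithinAt, fun t ht => ⟨(hball t ht).2, ?_⟩⟩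
  have hxt := ((hball t ht).1.differentiableAt one_ne_zero).hasDerivAt
  have hcomp := (hd (t, x t)).comp_hasDerivAt t ((hasDerivAt_id t).prodMk hxt)
  have hzero : (g ∘ fun s => (id s, x s)) =ᶠ[nhds t] fun _ => 0 := by
    filter_upwards [isOpen_Ioo.mem_nhds ht] with s hs using (hball s hs).2
  have heq : v (t, x t) + M (t, x t) *ᵥ deriv x t = 0 := by
    simpa using hcomp.unique ((hasDerivAt_const t (0 : n → ℝ)).congr_of_eventuallyEq hzero)
  have hdet := (Matrix.isUnit_iff_isUnit_det _).1 (hM (t, x t))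
  rwa [← Matrix.mulVec_neg, ← eq_neg_of_add_eq_zero_right heq, Matrix.mulVec_mulVec,
    Matrix.nonsing_inv_mul _ hdet, Matrix.one_mulVec]

/-- If `A` has full column rank and `∇_φΦ(φ₀, ε₀) = 0`, then there are `δ > 0` and a `C¹`
curve `φ` on `(ε₀ − δ, ε₀ + δ)` with `φ(ε₀) = φ₀`, `∇_φΦ(φ(ε), ε) = 0` for all `ε`, and
`φ'(ε) = −[D²_{φφ}Φ(φ(ε), ε)]⁻¹ ∂_ε∇_φΦ(φ(ε), ε)`.  Here `G` is the gradient of `Φ` in `φ`,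
`H` its Hessian in `φ` and `E` the `ε`-derivative of the gradient, given by their explicit
closed-form expressions. -/
theorem stmt_4
    (η : ℝ) (hη : 0 < η) (m e : ℕ) (hm : 0 < m) (he : 0 < e)
    (A : Matrix (Fin m) (Fin e) ℝ) (b : Fin e → ℝ) (c : Fin m → ℝ)
    (μ : Fin m → ℝ) (hμ : ∀ ℓ, 0 < μ ℓ)
    (Φ : (Fin e → ℝ) → ℝ → ℝ)
    (hΦ : ∀ φ ε, Φ φ ε =
      -(∑ j, b j * φ j) + η * ∑ ℓ, Real.exp ((∑ j, A ℓ j * φ j - ε * c ℓ) / η) * μ ℓ)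
    (G : (Fin e → ℝ) → ℝ → (Fin e → ℝ))
    (hG : ∀ φ ε, G φ ε = fun j =>
      -(b j) + ∑ ℓ, A ℓ j * (Real.exp ((∑ j', A ℓ j' * φ j' - ε * c ℓ) / η) * μ ℓ))
    (H : (Fin e → ℝ) → ℝ → Matrix (Fin e) (Fin e) ℝ)
    (hH : ∀ φ ε, H φ ε = (1 / η) •
      (Aᵀ * Matrix.diagonal (fun ℓ => Real.exp ((∑ j, A ℓ j * φ j - ε * c ℓ) / η) * μ ℓ) * A))
    (E : (Fin e → ℝ) → ℝ → (Fin e → ℝ))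
    (hE : ∀ φ ε, E φ ε = fun j =>
      -(1 / η) * ∑ ℓ, c ℓ * A ℓ j * (Real.exp ((∑ j', A ℓ j' * φ j' - ε * c ℓ) / η) * μ ℓ))
    (hrank : A.rank = e)
    (φ₀ : Fin e → ℝ) (ε₀ : ℝ) (hcrit : G φ₀ ε₀ = 0) :
    ∃ δ > 0, ∃ φ : ℝ → (Fin e → ℝ),
      φ ε₀ = φ₀ ∧
      ContDiffOn ℝ 1 φ (Set.Ioo (ε₀ - δ) (ε₀ + δ)) ∧
      ∀ ε ∈ Set.Ioo (ε₀ - δ) (ε₀ + δ),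
        G (φ ε) ε = 0 ∧
        HasDerivAt φ (-((H (φ ε) ε)⁻¹ *ᵥ E (φ ε) ε)) ε := by
  have hexponent (ℓ : Fin m) (p : ℝ × (Fin e → ℝ)) :
      HasFDerivAt (fun p : ℝ × (Fin e → ℝ) => (∑ j, A ℓ j * p.2 j - p.1 * c ℓ) / η)
        ((1 / η) • ((ContinuousLinearMap.proj ℓ ∘L A.mulVecLin.toContinuousLinearMap) ∘L
            ContinuousLinearMap.snd ℝ ℝ (Fin e → ℝ) -
          c ℓ • ContinuousLinearMap.fst ℝ ℝ (Fin e → ℝ))) p := by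
    convert! ((1 / η) • ((ContinuousLinearMap.proj ℓ ∘L A.mulVecLin.toContinuousLinearMap) ∘L
            ContinuousLinearMap.snd ℝ ℝ (Fin e → ℝ) -
          c ℓ • ContinuousLinearMap.fst ℝ ℝ (Fin e → ℝ))).hasFDerivAt using 1
    ext p
    simp [Matrix.mulVec, dotProduct]
    ring
  refine exists_contDiffOn_curve_of_isUnit (g := fun p => G p.2 p.1) (M := fun p => H p.2 p.1)
    (v := fun p => E p.2 p.1) ?_ (fun p => ?_) (fun p => ?_) hcrit
  · simp only [hG]
    fun_prop
  · rw [hH]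
    exact ((Matrix.posDef_transpose_mul_diagonal_mul_self (by simpa using hrank)
      fun ℓ => mul_pos (Real.exp_pos _) (hμ ℓ)).smul (one_div_pos.2 hη)).isUnit
  · simp only [hG]
    rw [hasFDerivAt_pi']
    intro j
    convert! (HasFDerivAt.fun_sum (u := Finset.univ) fun ℓ _ =>
      ((hexponent ℓ p).exp.mul_const (μ ℓ)).const_mul (A ℓ j)).const_add (-(b j)) using 1
    refine ContinuousLinearMap.ext fun q => ?_
    have hj : (H p.2 p.1 *ᵥ q.2) j = (1 / η) * ∑ ℓ, A ℓ j *
        (Real.exp ((∑ j', A ℓ j' * p.2 j' - p.1 * c ℓ) / η) * μ ℓ * (A *ᵥ q.2) ℓ) := by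
      rw [hH, Matrix.smul_mulVec, ← Matrix.mulVec_mulVec, ← Matrix.mulVec_mulVec, Pi.smul_apply,
        smul_eq_mul]
      change 1 / η * ∑ ℓ, A ℓ j * (Matrix.diagonal _ *ᵥ (A *ᵥ q.2)) ℓ = _
      simp only [Matrix.mulVec_diagonal]
    simp only [ContinuousLinearMap.comp_apply, _root_.add_apply, hE, hj,
      ContinuousLinearMap.smulRight_apply, ContinuousLinearMap.proj_apply, Pi.add_apply,
      Pi.smul_apply, smul_eq_mul, ContinuousLinearMap.coe_fst', ContinuousLinearMap.coe_snd',
      LinearMap.coe_toContinuousLinearMap', Matrix.mulVecLin_apply, _root_.sum_apply,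
      _root_.smul_apply, _root_.sub_apply, Finset.mul_sum, ← Finset.sum_add_distrib]
    exact Finset.sum_congr rfl fun ℓ _ => by ring
end

section
/- The value function C is differentiable at ε = 0 with C'(0) = −Σ_{r,s} c_{rs} μ_r ν_s, i.e. minus the expectation of the cost under the product measure μ ⊗ ν. -/
/-- A function squeezed between an affine function and a function tangent to it at `x` has the same
derivative at `x`. -/
theorem hasDerivAt_of_affine_le_of_le {f g : ℝ → ℝ} {a m x : ℝ}
    (hl : ∀ y, a + (y - x) * m ≤ f y) (hu : ∀ y, f y ≤ g y) (hgx : g x = a)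
    (hg : HasDerivAt g m x) : HasDerivAt f m x := by
  have hfx : f x = a := le_antisymm (hgx ▸ hu x) (by simpa using hl x)
  rw [hasDerivAt_iff_isLittleO] at hg ⊢
  refine (Asymptotics.IsBigO.of_bound 1 (Filter.Eventually.of_forall fun y => ?_)).trans_isLittleO hg
  have h1 := hl y
  have h2 := hu y
  simp only [smul_eq_mul, hfx, hgx, Real.norm_eq_abs, one_mul]
  rw [abs_of_nonneg (by linarith), abs_of_nonneg (by linarith)]
  linarith


/-- The value function `C(ε) = inf_{u,v} Φ(u, v, ε)` of the regularized two-marginal dual is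
differentiable at `ε = 0` with `C'(0) = −Σ_{r,s} c_{rs} μ_r ν_s`, minus the expectation of
the cost under the product measure. -/
theorem stmt_7
    (η : ℝ) (hη : 0 < η) (N M : ℕ) (hN : 0 < N) (hM : 0 < M)
    (μ : Fin N → ℝ) (ν : Fin M → ℝ) (hμ : ∀ r, 0 < μ r) (hν : ∀ s, 0 < ν s)
    (hμ1 : ∑ r, μ r = 1) (hν1 : ∑ s, ν s = 1)
    (c : Fin N → Fin M → ℝ)
    (Φ : (Fin N → ℝ) → (Fin M → ℝ) → ℝ → ℝ)
    (hΦ : ∀ u v ε, Φ u v ε = -(∑ r, u r * μ r) - (∑ s, v s * ν s)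
      + η * ∑ r, ∑ s, Real.exp ((u r + v s - ε * c r s) / η) * (μ r * ν s))
    (C : ℝ → ℝ)
    (hC : ∀ ε, C ε = ⨅ p : (Fin N → ℝ) × (Fin M → ℝ), Φ p.1 p.2 ε) :
    HasDerivAt C (-(∑ r, ∑ s, c r s * (μ r * ν s))) 0 := by
  have hπ : ∑ r, ∑ s, μ r * ν s = 1 := by
    rw [← Finset.sum_mul_sum, hμ1, hν1, one_mul]
  have hu : ∀ u : Fin N → ℝ, ∑ r, ∑ s, u r * (μ r * ν s) = ∑ r, u r * μ r := fun u => by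
    simp_rw [← mul_assoc, ← Finset.mul_sum, hν1, mul_one]
  have hv : ∀ v : Fin M → ℝ, ∑ r, ∑ s, v s * (μ r * ν s) = ∑ s, v s * ν s := fun v => by
    simp_rw [mul_left_comm (v _), ← Finset.mul_sum, ← Finset.sum_mul, hμ1, one_mul]
  have hconst : ∑ r, ∑ s, η * (μ r * ν s) = η := by
    rw [hu fun _ => η, ← Finset.mul_sum, hμ1, mul_one]
  have lower : ∀ u v ε, η + (ε - 0) * -(∑ r, ∑ s, c r s * (μ r * ν s)) ≤ Φ u v ε := by
    intro u v ε
    have key : ∑ r, ∑ s, (η + u r + v s - ε * c r s) * (μ r * ν s)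
        ≤ η * ∑ r, ∑ s, Real.exp ((u r + v s - ε * c r s) / η) * (μ r * ν s) := by
      simp_rw [Finset.mul_sum, ← mul_assoc η]
      refine Finset.sum_le_sum fun r _ => Finset.sum_le_sum fun s _ =>
        mul_le_mul_of_nonneg_right ?_ (mul_pos (hμ r) (hν s)).le
      calc η + u r + v s - ε * c r s = η * ((u r + v s - ε * c r s) / η + 1) := by
            field_simp; ring
        _ ≤ _ := mul_le_mul_of_nonneg_left (Real.add_one_le_exp _) hη.le
    have expand : ∑ r, ∑ s, (η + u r + v s - ε * c r s) * (μ r * ν s)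
        = η + ∑ r, u r * μ r + ∑ s, v s * ν s - ε * ∑ r, ∑ s, c r s * (μ r * ν s) := by
      simp_rw [sub_mul, add_mul, Finset.sum_sub_distrib, Finset.sum_add_distrib, hconst, hu, hv,
        mul_assoc ε, ← Finset.mul_sum]
    rw [hΦ]
    linarith
  refine hasDerivAt_of_affine_le_of_le (a := η) (g := Φ 0 0) (fun ε => ?_) (fun ε => ?_) ?_ ?_
  · rw [hC]
    exact le_ciInf fun p => lower p.1 p.2 ε
  · rw [hC]
    exact ciInf_le (f := fun p : (Fin N → ℝ) × (Fin M → ℝ) => Φ p.1 p.2 ε)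
      ⟨_, Set.forall_mem_range.2 fun p => lower p.1 p.2 ε⟩ (0, 0)
  · simp [hΦ, hπ]
  · have hΦ0 : Φ 0 0 = fun ε => η * ∑ r, ∑ s, Real.exp (-(ε * c r s) / η) * (μ r * ν s) := by
      funext ε
      simp [hΦ]
    have hexp : ∀ r s, HasDerivAt (fun ε => Real.exp (-(ε * c r s) / η) * (μ r * ν s))
        (-(c r s) / η * (μ r * ν s)) 0 := fun r s => by
      simpa using (((((hasDerivAt_id (0 : ℝ)).mul_const (c r s)).neg).div_const η).exp).mul_const
        (μ r * ν s)
    rw [hΦ0]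
    refine ((HasDerivAt.fun_sum fun r (_ : r ∈ Finset.univ) =>
      HasDerivAt.fun_sum fun s (_ : s ∈ Finset.univ) => hexp r s).const_mul η).congr_deriv ?_
    simp_rw [Finset.mul_sum, ← Finset.sum_neg_distrib]
    refine Finset.sum_congr rfl fun r _ => Finset.sum_congr rfl fun s _ => ?_
    field_simp
end

section
/- The value function C is twice differentiable at ε = 0 and C''(0) = (1/η)·[ (Σ_{r,s} c_{rs} μ_r ν_s)² + Σ_{r,s} c_{rs}² μ_r ν_s − Σ_r (Σ_s c_{rs} ν_s)² μ_r − Σ_s (Σ_r c_{rs} μ_r)² ν_s ]; equivalently, C''(0) = (1/η)·( (E[c])² + E[c²] − E[(E[c|X])²] − E[(E[c|Y])²] ), all expectations taken under the product measure μ ⊗ ν. -/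
/-- The dual entropic objective over a finite weighted index set: the potential `w` is charged
`w i` and penalised by `η * exp ((w i - ε * c i) / η)`, with weights `p`. -/
noncomputable def entropicObjective {ι : Type*} [Fintype ι] (η : ℝ) (p c w : ι → ℝ) (ε : ℝ) : ℝ :=
  ∑ i, p i * (η * Real.exp ((w i - ε * c i) / η) - w i)

theorem abs_le_exp_sub_self (x : ℝ) : |x| ≤ Real.exp x - x := by
  rcases le_total 0 x with h | h
  · rw [abs_of_nonneg h]
    nlinarith [Real.quadratic_le_exp_of_nonneg h, sq_nonneg (x - 1)]
  · rw [abs_of_nonpos h]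
    linarith [Real.exp_pos x]

theorem sq_le_one_add_abs_mul_exp_sub_one_mul (z : ℝ) :
    z ^ 2 ≤ (1 + |z|) * ((Real.exp z - 1) * z) := by
  rcases le_total 0 z with h | h
  · rw [abs_of_nonneg h]
    have h1 := Real.add_one_le_exp z
    have h2 : z * z ≤ (Real.exp z - 1) * z := mul_le_mul_of_nonneg_right (by linarith) h
    nlinarith
  · rw [abs_of_nonpos h]
    have h1 := Real.add_one_le_exp (-z)
    have h2 : Real.exp (-z) * Real.exp z = 1 := by rw [← Real.exp_add]; simp
    have h3 : (1 - z) * Real.exp z ≤ 1 := by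
      rw [← h2]
      exact mul_le_mul_of_nonneg_right (by linarith) (Real.exp_pos z).le
    nlinarith

theorem continuous_entropicObjective {ι : Type*} [Fintype ι] (η : ℝ) (p c : ι → ℝ) (ε : ℝ) :
    Continuous fun w => entropicObjective η p c w ε := by
  unfold entropicObjective
  fun_prop

theorem abs_sub_le_of_entropicObjective {ι : Type*} [Fintype ι] {η : ℝ} (hη : 0 < η)
    {p : ι → ℝ} (hp : ∀ i, 0 < p i) (c w : ι → ℝ) (ε : ℝ) (i : ι) :
    p i * |w i - ε * c i| ≤ entropicObjective η p c w ε + ∑ j, p j * (ε * c j) := by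
  have key : ∀ j, p j * |w j - ε * c j| ≤
      p j * (η * Real.exp ((w j - ε * c j) / η) - w j) + p j * (ε * c j) := by
    intro j
    rw [← mul_add]
    refine mul_le_mul_of_nonneg_left ?_ (hp j).le
    have h := mul_le_mul_of_nonneg_left (abs_le_exp_sub_self ((w j - ε * c j) / η)) hη.le
    rw [abs_div, abs_of_pos hη, mul_sub, mul_div_cancel₀ _ hη.ne', mul_div_cancel₀ _ hη.ne'] at h
    linarith
  unfold entropicObjective
  rw [← Finset.sum_add_distrib]
  refine le_trans ?_ (Finset.sum_le_sum fun j _ => key j)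
  exact Finset.single_le_sum (f := fun j => p j * |w j - ε * c j|)
    (fun j _ => mul_nonneg (hp j).le (abs_nonneg _)) (Finset.mem_univ i)

theorem exists_entropicObjective_minimizer {ι : Type*} [Fintype ι] {η : ℝ} (hη : 0 < η)
    {p : ι → ℝ} (hp : ∀ i, 0 < p i) (c : ι → ℝ) (S : Submodule ℝ (ι → ℝ)) (ε : ℝ) :
    ∃ w ∈ S, ∀ w' ∈ S, entropicObjective η p c w ε ≤ entropicObjective η p c w' ε := by
  have hcont := continuous_entropicObjective η p c ε
  set A := entropicObjective η p c 0 ε + ∑ j, p j * (ε * c j) with hA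
  let K : Set (ι → ℝ) :=
    {w | w ∈ S ∧ entropicObjective η p c w ε ≤ entropicObjective η p c 0 ε}
  have hclosed : IsClosed K :=
    (Submodule.closed_of_finiteDimensional S).inter (isClosed_le hcont continuous_const)
  have hbdd : Bornology.IsBounded K := by
    refine (Metric.isBounded_closedBall (x := fun i => ε * c i)
      (r := ∑ i, |A / p i|)).subset fun w hw => ?_
    rw [Metric.mem_closedBall, dist_pi_le_iff (Finset.sum_nonneg fun i _ => abs_nonneg _)]
    intro i
    rw [Real.dist_eq]
    have h := abs_sub_le_of_entropicObjective hη hp c w ε i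
    have h2 : |w i - ε * c i| ≤ A / p i := by
      rw [le_div_iff₀ (hp i)]
      linarith [hw.2]
    exact h2.trans ((le_abs_self _).trans (Finset.single_le_sum (f := fun i => |A / p i|)
      (fun i _ => abs_nonneg _) (Finset.mem_univ i)))
  obtain ⟨w, hwK, hw⟩ := (Metric.isCompact_of_isClosed_isBounded hclosed hbdd).exists_isMinOn
    ⟨0, S.zero_mem, le_rfl⟩ hcont.continuousOn
  refine ⟨w, hwK.1, fun w' hw' => ?_⟩
  by_cases h : entropicObjective η p c w' ε ≤ entropicObjective η p c 0 ε
  · exact hw ⟨hw', h⟩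
  · exact hwK.2.trans (not_le.1 h).le

theorem entropicObjective_first_order {ι : Type*} [Fintype ι] {η : ℝ} (hη : 0 < η)
    {p c w : ι → ℝ} {S : Submodule ℝ (ι → ℝ)} {ε : ℝ} (hw : w ∈ S)
    (hmin : ∀ w' ∈ S, entropicObjective η p c w ε ≤ entropicObjective η p c w' ε)
    {h : ι → ℝ} (hh : h ∈ S) :
    ∑ i, p i * (Real.exp ((w i - ε * c i) / η) - 1) * h i = 0 := by
  have hd : HasDerivAt (fun t : ℝ => entropicObjective η p c (w + t • h) ε)
      (∑ i, p i * (Real.exp ((w i - ε * c i) / η) - 1) * h i) 0 := by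
    unfold entropicObjective
    refine HasDerivAt.fun_sum fun i _ => ?_
    have h1 : HasDerivAt (fun t : ℝ => (w + t • h) i) (h i) 0 := by
      simpa using ((hasDerivAt_id (0 : ℝ)).mul_const (h i)).const_add (w i)
    refine ((((((h1.sub_const (ε * c i)).div_const η).exp).const_mul η).sub h1).const_mul
      (p i)).congr_deriv ?_
    simp only [zero_smul, add_zero]
    field_simp
  refine IsLocalMin.hasDerivAt_eq_zero (Filter.Eventually.of_forall fun t => ?_) hd
  simpa using hmin _ (S.add_mem hw (S.smul_mem t hh))

theorem le_entropicObjective_of_minimizer {ι : Type*} [Fintype ι] {η : ℝ} (hη : 0 < η)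
    {p : ι → ℝ} (hp : ∀ i, 0 < p i) {c w : ι → ℝ} {S : Submodule ℝ (ι → ℝ)} {ε : ℝ} (hw : w ∈ S)
    (hmin : ∀ w' ∈ S, entropicObjective η p c w ε ≤ entropicObjective η p c w' ε)
    {w' : ι → ℝ} (hw' : w' ∈ S) (ε' : ℝ) :
    entropicObjective η p c w ε
        + (ε' - ε) * -∑ i, p i * (Real.exp ((w i - ε * c i) / η) * c i)
      ≤ entropicObjective η p c w' ε' := by
  have h0 := entropicObjective_first_order hη hw hmin (S.sub_mem hw' hw)
  rw [← add_zero (_ + _), ← h0]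
  unfold entropicObjective
  rw [mul_neg, Finset.mul_sum, ← Finset.sum_neg_distrib, ← Finset.sum_add_distrib,
    ← Finset.sum_add_distrib]
  refine Finset.sum_le_sum fun i _ => ?_
  have h1 : Real.exp ((w i - ε * c i) / η) * (1 + ((w' i - ε' * c i) - (w i - ε * c i)) / η)
      ≤ Real.exp ((w' i - ε' * c i) / η) := by
    have : (w' i - ε' * c i) / η =
        (w i - ε * c i) / η + ((w' i - ε' * c i) - (w i - ε * c i)) / η := by ring
    rw [this, Real.exp_add]
    refine mul_le_mul_of_nonneg_left ?_ (Real.exp_pos _).le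
    linarith [Real.add_one_le_exp (((w' i - ε' * c i) - (w i - ε * c i)) / η)]
  have h2 := mul_le_mul_of_nonneg_left (mul_le_mul_of_nonneg_left h1 hη.le) (hp i).le
  have h3 : η * (Real.exp ((w i - ε * c i) / η) *
      (1 + ((w' i - ε' * c i) - (w i - ε * c i)) / η)) =
      Real.exp ((w i - ε * c i) / η) * (η + ((w' i - ε' * c i) - (w i - ε * c i))) := by
    field_simp
  rw [h3] at h2
  simp only [Pi.sub_apply]
  linarith

theorem HasDerivAt.of_le_of_affine_le {f g : ℝ → ℝ} {a D : ℝ} (hg : HasDerivAt g D a)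
    (ha : f a = g a) (hfg : ∀ x, f x ≤ g x) (hf : ∀ x, f a + (x - a) * D ≤ f x) :
    HasDerivAt f D a := by
  rw [hasDerivAt_iff_isLittleO] at hg ⊢
  refine Asymptotics.IsBigO.trans_isLittleO (Asymptotics.IsBigO.of_bound 1
    (Filter.Eventually.of_forall fun x => ?_)) hg
  have h1 := hf x
  have h2 := hfg x
  simp only [smul_eq_mul, one_mul, Real.norm_eq_abs]
  rw [abs_of_nonneg (by linarith), abs_of_nonneg (by linarith)]
  linarith

theorem hasDerivAt_entropicObjective {ι : Type*} [Fintype ι] {η : ℝ} (hη : 0 < η)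
    (p c w : ι → ℝ) (ε : ℝ) :
    HasDerivAt (entropicObjective η p c w)
      (-∑ i, p i * (Real.exp ((w i - ε * c i) / η) * c i)) ε := by
  unfold entropicObjective
  rw [← Finset.sum_neg_distrib]
  refine HasDerivAt.fun_sum fun i _ => ?_
  refine (((((((hasDerivAt_id ε).mul_const (c i)).const_sub (w i)).div_const η).exp.const_mul
    η).sub_const (w i)).const_mul (p i)).congr_deriv ?_
  simp only [id_eq]
  field_simp

theorem abs_le_of_sum_mul_exp_sub_one_mul_le {ι : Type*} [Fintype ι] {q z : ι → ℝ} {b δ : ℝ}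
    (hb : 0 < b) (hq : ∀ i, b ≤ q i) (hδ : δ ≤ b / 2)
    (h : ∀ Z, (∀ i, |z i| ≤ Z) → ∑ i, q i * ((Real.exp (z i) - 1) * z i) ≤ δ * Z) (i : ι) :
    |z i| ≤ 2 * δ / b := by
  have : Nonempty ι := ⟨i⟩
  obtain ⟨j, hj⟩ := Finite.exists_max fun i => |z i|
  refine (hj i).trans ?_
  have hpos : ∀ k, 0 ≤ (Real.exp (z k) - 1) * z k := fun k => by
    have h1 := (sq_nonneg (z k)).trans (sq_le_one_add_abs_mul_exp_sub_one_mul (z k))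
    exact nonneg_of_mul_nonneg_right h1 (by positivity)
  have h1 : b * ((Real.exp (z j) - 1) * z j) ≤ δ * |z j| := by
    refine (mul_le_mul_of_nonneg_right (hq j) (hpos j)).trans (le_trans ?_ (h _ hj))
    exact Finset.single_le_sum (f := fun k => q k * ((Real.exp (z k) - 1) * z k))
      (fun k _ => mul_nonneg (hb.le.trans (hq k)) (hpos k)) (Finset.mem_univ j)
  have h2 := sq_le_one_add_abs_mul_exp_sub_one_mul (z j)
  rw [le_div_iff₀ hb]
  have h3 : b * z j ^ 2 ≤ (1 + |z j|) * (δ * |z j|) := by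
    calc b * z j ^ 2 ≤ b * ((1 + |z j|) * ((Real.exp (z j) - 1) * z j)) := by gcongr
      _ = (1 + |z j|) * (b * ((Real.exp (z j) - 1) * z j)) := by ring
      _ ≤ _ := by gcongr
  rcases (abs_nonneg (z j)).eq_or_lt with h0 | h0
  · rw [← h0] at hj
    have : 0 ≤ δ := by
      have := h 1 fun k => (hj k).trans zero_le_one
      refine le_trans (Finset.sum_nonneg fun k _ => mul_nonneg (hb.le.trans (hq k)) (hpos k))
        (this.trans (by simp))
    rw [← h0]; linarith
  · rw [← sq_abs] at h3
    have h4 : b * |z j| ≤ (1 + |z j|) * δ := by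
      refine le_of_mul_le_mul_right ?_ h0
      linarith
    nlinarith

theorem exists_minimizer_displacement_le {ι : Type*} [Fintype ι] {η : ℝ} (hη : 0 < η)
    {p : ι → ℝ} (hp : ∀ i, 0 < p i) {c d : ι → ℝ} {S : Submodule ℝ (ι → ℝ)}
    (hcd : c - d ∈ S) (hd : ∀ h ∈ S, ∑ i, p i * d i * h i = 0) :
    ∃ K : ℝ, ∀ᶠ ε in nhds (0 : ℝ), ∀ w ∈ S,
      (∀ w' ∈ S, entropicObjective η p c w ε ≤ entropicObjective η p c w' ε) →
      ∀ i, |(w i - ε * c i) / η + ε * (d i / η)| ≤ K * ε ^ 2 := by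
  rcases isEmpty_or_nonempty ι with hι | hι
  · exact ⟨0, Filter.Eventually.of_forall fun ε w _ _ i => (hι.false i).elim⟩
  obtain ⟨j, hj⟩ := Finite.exists_min p
  set b := p j * Real.exp (-1) with hb
  have hbpos : 0 < b := mul_pos (hp j) (Real.exp_pos _)
  set B := ∑ i, p i * (d i / η) ^ 2 with hB
  refine ⟨2 * B / b, ?_⟩
  have e1 : ∀ᶠ ε in nhds (0 : ℝ), ∀ i, |ε * (d i / η)| < 1 := by
    rw [Filter.eventually_all]
    intro i
    have : ContinuousAt (fun ε : ℝ => |ε * (d i / η)|) 0 := by fun_prop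
    exact this.eventually_lt continuousAt_const (by simp)
  have e2 : ∀ᶠ ε in nhds (0 : ℝ), B * ε ^ 2 < b / 2 := by
    have : ContinuousAt (fun ε : ℝ => B * ε ^ 2) 0 := by fun_prop
    exact this.eventually_lt continuousAt_const (by simpa using hbpos)
  filter_upwards [e1, e2] with ε h1 h2 w hw hmin i
  have key := abs_le_of_sum_mul_exp_sub_one_mul_le
    (q := fun i => p i * Real.exp (-(ε * (d i / η))))
    (z := fun i => (w i - ε * c i) / η + ε * (d i / η)) hbpos (fun i => ?_) h2.le (fun Z hZ => ?_) i
  · refine key.trans (le_of_eq (by ring))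
  · exact mul_le_mul (hj i) (Real.exp_le_exp.2 (by linarith [le_abs_self (ε * (d i / η)), h1 i]))
      (Real.exp_pos _).le (hp i).le
  · have ht : w - ε • (c - d) ∈ S := S.sub_mem hw (S.smul_mem ε hcd)
    have o1 := entropicObjective_first_order hη hw hmin ht
    have o2 := hd _ ht
    have : ∑ i, p i * Real.exp (-(ε * (d i / η))) *
        ((Real.exp ((w i - ε * c i) / η + ε * (d i / η)) - 1) *
          ((w i - ε * c i) / η + ε * (d i / η))) =
        ∑ i, -(p i * (Real.exp (-(ε * (d i / η))) - 1 - -(ε * (d i / η))) *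
          ((w i - ε * c i) / η + ε * (d i / η))) := by
      rw [← sub_eq_zero, ← Finset.sum_sub_distrib]
      have hcomb : (1 / η) * (∑ i, p i * (Real.exp ((w i - ε * c i) / η) - 1) *
          (w - ε • (c - d)) i) + (ε / η ^ 2) *
          (∑ i, p i * d i * (w - ε • (c - d)) i) = 0 := by rw [o1, o2]; simp
      rw [← hcomb, Finset.mul_sum, Finset.mul_sum, ← Finset.sum_add_distrib]
      refine Finset.sum_congr rfl fun i _ => ?_
      have he : Real.exp ((w i - ε * c i) / η) =
          Real.exp (-(ε * (d i / η))) * Real.exp ((w i - ε * c i) / η + ε * (d i / η)) := by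
        rw [← Real.exp_add]; congr 1; ring
      rw [he]
      simp only [Pi.sub_apply, Pi.smul_apply, smul_eq_mul]
      field_simp
      ring
    rw [this, hB, Finset.sum_mul, Finset.sum_mul]
    refine Finset.sum_le_sum fun i _ => ?_
    have hq : |Real.exp (-(ε * (d i / η))) - 1 - -(ε * (d i / η))| ≤ (ε * (d i / η)) ^ 2 := by
      have := Real.abs_exp_sub_one_sub_id_le (x := -(ε * (d i / η)))
        (by rw [abs_neg]; exact (h1 i).le)
      simpa using this
    refine (neg_le_abs _).trans ?_
    rw [abs_mul, abs_mul, abs_of_pos (hp i)]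
    calc _ ≤ p i * (ε * (d i / η)) ^ 2 * Z := by
          gcongr
          · exact mul_nonneg (hp i).le (sq_nonneg _)
          · exact (hp i).le
          · exact hZ i
      _ = _ := by ring

/-- Differentiability of the value function of the dual entropic problem over a subspace `S`, and
its second derivative at `0` in terms of the component `d` of `c` orthogonal to `S`. -/
theorem entropicValue_hasDerivAt_deriv {ι : Type*} [Fintype ι] {η : ℝ} (hη : 0 < η)
    {p : ι → ℝ} (hp : ∀ i, 0 < p i) {c d : ι → ℝ} {S : Submodule ℝ (ι → ℝ)}
    (hcd : c - d ∈ S) (hd : ∀ h ∈ S, ∑ i, p i * d i * h i = 0) {C : ℝ → ℝ}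
    (hC : ∀ ε, C ε = sInf ((fun w => entropicObjective η p c w ε) '' (S : Set (ι → ℝ)))) :
    Differentiable ℝ C ∧ HasDerivAt (deriv C) ((1 / η) * ∑ i, p i * d i * c i) 0 := by
  choose w hw hmin using exists_entropicObjective_minimizer hη hp c S
  have hleast : ∀ ε, IsLeast ((fun w => entropicObjective η p c w ε) '' (S : Set (ι → ℝ)))
      (entropicObjective η p c (w ε) ε) := fun ε =>
    ⟨⟨w ε, hw ε, rfl⟩, by rintro _ ⟨w', hw', rfl⟩; exact hmin ε w' hw'⟩
  have hCw : ∀ ε, C ε = entropicObjective η p c (w ε) ε := fun ε => by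
    rw [hC, (hleast ε).csInf_eq]
  have hderiv : ∀ ε, HasDerivAt C
      (-∑ i, p i * (Real.exp ((w ε i - ε * c i) / η) * c i)) ε := fun ε => by
    refine (hasDerivAt_entropicObjective hη p c (w ε) ε).of_le_of_affine_le (hCw ε)
      (fun x => ?_) fun x => ?_
    · rw [hCw]
      exact hmin x _ (hw ε)
    · rw [hCw, hCw]
      exact le_entropicObjective_of_minimizer hη hp (hw ε) (hmin ε) (hw x) x
  refine ⟨fun ε => (hderiv ε).differentiableAt, ?_⟩
  rw [funext fun ε => (hderiv ε).deriv]
  obtain ⟨K, hK⟩ := exists_minimizer_displacement_le hη hp hcd hd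
  have hx0 : ∀ i, (w 0 i - 0 * c i) / η = 0 := fun i => by
    have := hK.self_of_nhds (w 0) (hw 0) (hmin 0) i
    simpa using this
  have hx : ∀ i, HasDerivAt (fun ε => (w ε i - ε * c i) / η) (-(d i / η)) 0 := fun i => by
    rw [hasDerivAt_iff_isLittleO]
    refine Asymptotics.IsBigO.trans_isLittleO (g := fun ε : ℝ => ε ^ 2)
      (Asymptotics.IsBigO.of_bound K ?_) ?_
    · filter_upwards [hK] with ε hε
      have := hε (w ε) (hw ε) (hmin ε) i
      rw [hx0]
      simp only [smul_eq_mul, Real.norm_eq_abs, sub_zero, abs_pow, sq_abs, mul_neg, sub_neg_eq_add]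
      exact this
    · simpa using Asymptotics.isLittleO_pow_id (𝕜 := ℝ) one_lt_two
  have hsum := (HasDerivAt.fun_sum (u := Finset.univ) fun i _ =>
    (((hx i).exp.mul_const (c i)).const_mul (p i))).fun_neg
  refine hsum.congr_deriv ?_
  rw [← Finset.sum_neg_distrib, Finset.mul_sum]
  refine Finset.sum_congr rfl fun i _ => ?_
  rw [hx0, Real.exp_zero]
  ring


/-- The value function `C(ε) = inf_{u,v} Φ(u, v, ε)` is twice differentiable at `ε = 0` with
`C''(0) = (1/η)·[(E[c])² + E[c²] − E[(E[c|X])²] − E[(E[c|Y])²]]`, expectations under the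
product measure `μ ⊗ ν`. -/
theorem stmt_8
    (η : ℝ) (hη : 0 < η) (N M : ℕ) (hN : 0 < N) (hM : 0 < M)
    (μ : Fin N → ℝ) (ν : Fin M → ℝ) (hμ : ∀ r, 0 < μ r) (hν : ∀ s, 0 < ν s)
    (hμ1 : ∑ r, μ r = 1) (hν1 : ∑ s, ν s = 1)
    (c : Fin N → Fin M → ℝ)
    (Φ : (Fin N → ℝ) → (Fin M → ℝ) → ℝ → ℝ)
    (hΦ : ∀ u v ε, Φ u v ε = -(∑ r, u r * μ r) - (∑ s, v s * ν s)
      + η * ∑ r, ∑ s, Real.exp ((u r + v s - ε * c r s) / η) * (μ r * ν s))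
    (C : ℝ → ℝ)
    (hC : ∀ ε, C ε = ⨅ p : (Fin N → ℝ) × (Fin M → ℝ), Φ p.1 p.2 ε) :
    (∀ᶠ ε in nhds 0, DifferentiableAt ℝ C ε) ∧
    HasDerivAt (deriv C)
      ((1 / η) * ((∑ r, ∑ s, c r s * (μ r * ν s)) ^ 2
        + (∑ r, ∑ s, (c r s) ^ 2 * (μ r * ν s))
        - (∑ r, (∑ s, c r s * ν s) ^ 2 * μ r)
        - (∑ s, (∑ r, c r s * μ r) ^ 2 * ν s))) 0 := by
  let p : Fin N × Fin M → ℝ := fun i => μ i.1 * ν i.2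
  let k : Fin N × Fin M → ℝ := fun i => c i.1 i.2
  let a : Fin N → ℝ := fun r => ∑ s, c r s * ν s
  let b : Fin M → ℝ := fun s => ∑ r, c r s * μ r
  let m : ℝ := ∑ r, ∑ s, c r s * (μ r * ν s)
  let d : Fin N × Fin M → ℝ := fun i => c i.1 i.2 - a i.1 - b i.2 + m
  let L : ((Fin N → ℝ) × (Fin M → ℝ)) →ₗ[ℝ] (Fin N × Fin M → ℝ) :=
    { toFun := fun q i => q.1 i.1 + q.2 i.2
      map_add' := fun x y => by ext i; simp only [Prod.fst_add, Prod.snd_add, Pi.add_apply]; ring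
      map_smul' := fun t x => by ext i; simp [mul_add] }
  have hma : m = ∑ r, a r * μ r := by
    simp only [m, a, Finset.sum_mul]
    exact Finset.sum_congr rfl fun r _ => Finset.sum_congr rfl fun s _ => by ring
  have hmb : m = ∑ s, b s * ν s := by
    simp only [m, b, Finset.sum_mul]
    rw [Finset.sum_comm]
    exact Finset.sum_congr rfl fun r _ => Finset.sum_congr rfl fun s _ => by ring
  have hrow : ∀ r, ∑ s, ν s * d (r, s) = 0 := fun r => by
    have : ∀ s, ν s * d (r, s) = c r s * ν s - a r * ν s - b s * ν s + m * ν s := fun s => by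
      simp only [d]; ring
    simp only [this, Finset.sum_add_distrib, Finset.sum_sub_distrib, ← Finset.mul_sum, hν1, ← hmb]
    simp [a]
  have hcol : ∀ s, ∑ r, μ r * d (r, s) = 0 := fun s => by
    have : ∀ r, μ r * d (r, s) = c r s * μ r - a r * μ r - b s * μ r + m * μ r := fun r => by
      simp only [d]; ring
    simp only [this, Finset.sum_add_distrib, Finset.sum_sub_distrib, ← Finset.mul_sum, hμ1, ← hma]
    simp [b]
  have horth : ∀ h ∈ LinearMap.range L, ∑ i, p i * d i * h i = 0 := by
    rintro _ ⟨⟨u, v⟩, rfl⟩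
    have e : ∀ r s, p (r, s) * d (r, s) * L (u, v) (r, s) =
        u r * μ r * (ν s * d (r, s)) + v s * ν s * (μ r * d (r, s)) := fun r s => by
      simp only [p, L, LinearMap.coe_mk, AddHom.coe_mk]; ring
    rw [Fintype.sum_prod_type]
    simp only [e, Finset.sum_add_distrib]
    rw [Finset.sum_comm (f := fun r s => v s * ν s * (μ r * d (r, s)))]
    simp only [← Finset.mul_sum, hrow, hcol]
    simp
  have hmem : k - d ∈ LinearMap.range L := by
    refine ⟨(a, fun s => b s - m), ?_⟩
    ext i
    simp only [k, d, L, LinearMap.coe_mk, AddHom.coe_mk, Pi.sub_apply]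
    ring
  have hΦL : ∀ q ε, Φ q.1 q.2 ε = entropicObjective η p k (L q) ε := by
    rintro ⟨u, v⟩ ε
    have e : ∀ r s, p (r, s) * (η * Real.exp ((L (u, v) (r, s) - ε * k (r, s)) / η)
        - L (u, v) (r, s)) = η * (Real.exp ((u r + v s - ε * c r s) / η) * (μ r * ν s))
          - u r * μ r * ν s - v s * ν s * μ r := fun r s => by
      simp only [p, k, L, LinearMap.coe_mk, AddHom.coe_mk]; ring
    rw [hΦ, entropicObjective, Fintype.sum_prod_type]
    simp only [e, Finset.sum_sub_distrib]
    rw [Finset.sum_comm (f := fun r s => v s * ν s * μ r)]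
    simp only [← Finset.mul_sum, hμ1, hν1, mul_one]
    ring
  have hCS : ∀ ε, C ε = sInf ((fun w => entropicObjective η p k w ε) ''
      (LinearMap.range L : Set (Fin N × Fin M → ℝ))) := fun ε => by
    rw [hC, iInf, LinearMap.coe_range, ← Set.range_comp]
    exact congrArg (fun f => sInf (Set.range f)) (funext fun q => hΦL q ε)
  obtain ⟨h1, h2⟩ := entropicValue_hasDerivAt_deriv hη
    (fun i : Fin N × Fin M => mul_pos (hμ i.1) (hν i.2)) hmem horth hCS
  refine ⟨Filter.Eventually.of_forall h1, ?_⟩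
  convert h2 using 2
  have e : ∀ r s, μ r * ν s * d (r, s) * k (r, s) = c r s ^ 2 * (μ r * ν s)
      - a r * μ r * (c r s * ν s) - b s * ν s * (c r s * μ r)
      + m * (c r s * (μ r * ν s)) := fun r s => by
    simp only [k, d]; ring
  rw [Fintype.sum_prod_type]
  simp only [e, Finset.sum_add_distrib, Finset.sum_sub_distrib]
  rw [Finset.sum_comm (f := fun r s => b s * ν s * (c r s * μ r))]
  simp only [← Finset.mul_sum]
  change m ^ 2 + _ - (∑ r, a r ^ 2 * μ r) - (∑ s, b s ^ 2 * ν s) =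
    _ - (∑ r, a r * μ r * a r) - (∑ s, b s * ν s * b s) + m * m
  have ea : ∑ r, a r * μ r * a r = ∑ r, a r ^ 2 * μ r :=
    Finset.sum_congr rfl fun r _ => by ring
  have eb : ∑ s, b s * ν s * b s = ∑ s, b s ^ 2 * ν s :=
    Finset.sum_congr rfl fun s _ => by ring
  rw [ea, eb]
  ring
end

section
/- For any real N×M matrix (c_{rs}) and any probability weights μ_1, …, μ_N > 0 and ν_1, …, ν_M > 0 with Σ_r μ_r = 1 and Σ_s ν_s = 1, the following inequality holds: (Σ_{r,s} c_{rs} μ_r ν_s)² + Σ_{r,s} c_{rs}² μ_r ν_s ≥ Σ_r (Σ_s c_{rs} ν_s)² μ_r + Σ_s (Σ_r c_{rs} μ_r)² ν_s. (Equivalently, (E[c])² + E[c²] ≥ E[(E[c|X])²] + E[(E[c|Y])²] under the product measure; this is the nonnegativity of C''(0).) -/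
/-- The variance of `x` under the weights `w` is the second moment minus the squared mean. -/
theorem sum_sub_mean_sq_mul {ι : Type*} [Fintype ι] (x w : ι → ℝ) (hw : ∑ i, w i = 1) :
    ∑ i, (x i - ∑ j, x j * w j) ^ 2 * w i = ∑ i, x i ^ 2 * w i - (∑ i, x i * w i) ^ 2 := by
  set m := ∑ j, x j * w j with hm
  have h : ∀ i, (x i - m) ^ 2 * w i = x i ^ 2 * w i - 2 * m * (x i * w i) + m ^ 2 * w i :=
    fun i => by ring
  simp only [h, Finset.sum_add_distrib, Finset.sum_sub_distrib, ← Finset.mul_sum, hw, ← hm]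
  ring

/-- Jensen's inequality for the square: the squared mean is at most the second moment. -/
theorem sq_sum_mul_le_sum_sq_mul {ι : Type*} [Fintype ι] (x w : ι → ℝ) (hw₀ : ∀ i, 0 ≤ w i)
    (hw : ∑ i, w i = 1) : (∑ i, x i * w i) ^ 2 ≤ ∑ i, x i ^ 2 * w i := by
  rw [← sub_nonneg, ← sum_sub_mean_sq_mul x w hw]
  exact Finset.sum_nonneg fun i _ => mul_nonneg (sq_nonneg _) (hw₀ i)


/-- Nonnegativity of `C''(0)`: for any cost matrix `c` and probability weights `μ, ν`,
`(E[c])² + E[c²] ≥ E[(E[c|X])²] + E[(E[c|Y])²]` under the product measure. -/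
theorem stmt_9
    (N M : ℕ) (hN : 0 < N) (hM : 0 < M)
    (c : Fin N → Fin M → ℝ)
    (μ : Fin N → ℝ) (ν : Fin M → ℝ) (hμ : ∀ r, 0 < μ r) (hν : ∀ s, 0 < ν s)
    (hμ1 : ∑ r, μ r = 1) (hν1 : ∑ s, ν s = 1) :
    (∑ r, (∑ s, c r s * ν s) ^ 2 * μ r) + (∑ s, (∑ r, c r s * μ r) ^ 2 * ν s)
      ≤ (∑ r, ∑ s, c r s * (μ r * ν s)) ^ 2 + ∑ r, ∑ s, (c r s) ^ 2 * (μ r * ν s) := by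
  set a : Fin N → ℝ := fun r => ∑ s, c r s * ν s with ha
  set b : Fin M → ℝ := fun s => ∑ r, c r s * μ r with hb
  have mean_a : ∑ r, ∑ s, c r s * (μ r * ν s) = ∑ r, a r * μ r := by
    simp only [ha, Finset.sum_mul]
    exact Finset.sum_congr rfl fun r _ => Finset.sum_congr rfl fun s _ => by ring
  have mean_b : ∑ r, a r * μ r = ∑ s, b s * ν s := by
    simp only [ha, hb, Finset.sum_mul]
    rw [Finset.sum_comm]
    exact Finset.sum_congr rfl fun s _ => Finset.sum_congr rfl fun r _ => by ring
  have jensen : ∑ s, (b s - ∑ r, a r * μ r) ^ 2 * ν s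
      ≤ ∑ s, (∑ r, (c r s - a r) ^ 2 * μ r) * ν s := by
    refine Finset.sum_le_sum fun s _ => mul_le_mul_of_nonneg_right ?_ (hν s).le
    have h := sq_sum_mul_le_sum_sq_mul (fun r => c r s - a r) μ (fun r => (hμ r).le) hμ1
    simpa only [sub_mul, Finset.sum_sub_distrib] using h
  have rows : ∑ s, (∑ r, (c r s - a r) ^ 2 * μ r) * ν s
      = ∑ r, ∑ s, c r s ^ 2 * (μ r * ν s) - ∑ r, a r ^ 2 * μ r := by
    calc ∑ s, (∑ r, (c r s - a r) ^ 2 * μ r) * ν s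
        = ∑ r, (∑ s, (c r s - a r) ^ 2 * ν s) * μ r := by
          simp only [Finset.sum_mul]
          rw [Finset.sum_comm]
          exact Finset.sum_congr rfl fun r _ => Finset.sum_congr rfl fun s _ => by ring
      _ = ∑ r, (∑ s, c r s ^ 2 * ν s - a r ^ 2) * μ r :=
          Finset.sum_congr rfl fun r _ => by rw [← sum_sub_mean_sq_mul (c r) ν hν1]
      _ = _ := by
          simp only [sub_mul, Finset.sum_sub_distrib, Finset.sum_mul]
          congr 1
          exact Finset.sum_congr rfl fun r _ => Finset.sum_congr rfl fun s _ => by ring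
  rw [rows, mean_b, sum_sub_mean_sq_mul b ν hν1] at jensen
  rw [mean_a, mean_b]
  linarith
end

section
/- If (u(ε), v(ε)) is a differentiable curve defined on an open interval I such that for every ε ∈ I the pair (u(ε), v(ε)) is a critical point of (u, v) ↦ Φ(u, v, ε), then the function ε ↦ Φ(u(ε), v(ε), ε) is differentiable on I with derivative equal to ∂Φ/∂ε evaluated along the curve, namely d/dε Φ(u(ε), v(ε), ε) = −Σ_{r,s} c_{rs}·exp((u_r(ε) + v_s(ε) − ε c_{rs})/η)·μ_r ν_s (envelope formula for the optimal value). -/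
/-- Envelope theorem: along a differentiable curve `γ`, if the derivative of `F` in its first
argument vanishes at `(γ t, t)`, then `s ↦ F (γ s) s` has at `t` the derivative of `F` in its
second argument. -/
theorem hasDerivAt_envelope {E : Type*} [NormedAddCommGroup E] [NormedSpace ℝ E]
    {F : E → ℝ → ℝ} {γ : ℝ → E} {t d : ℝ}
    (hF : DifferentiableAt ℝ (fun q : E × ℝ => F q.1 q.2) (γ t, t))
    (hγ : DifferentiableAt ℝ γ t)
    (hcrit : fderiv ℝ (fun x => F x t) (γ t) = 0)
    (hd : HasDerivAt (fun s => F (γ t) s) d t) :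
    HasDerivAt (fun s => F (γ s) s) d t := by
  set L := fderiv ℝ (fun q : E × ℝ => F q.1 q.2) (γ t, t)
  have hL : HasFDerivAt (fun q : E × ℝ => F q.1 q.2) L (γ t, t) := hF.hasFDerivAt
  have hfst : L.comp (ContinuousLinearMap.inl ℝ E ℝ) = 0 := by
    rw [← hcrit]
    exact (hL.comp (f := fun x => (x, t)) (γ t) (hasFDerivAt_prodMk_left (γ t) t)).fderiv.symm
  have hsnd : L (0, 1) = d :=
    (hL.comp_hasDerivAt (f := fun s => (γ t, s)) t
      ((hasDerivAt_const t (γ t)).prodMk (hasDerivAt_id t))).unique hd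
  have hcurve := hL.comp_hasDerivAt (f := fun s => (γ s, s)) t
    (hγ.hasDerivAt.prodMk (hasDerivAt_id t))
  have hsplit : L (deriv γ t, 1) = d := by
    have h0 : L (deriv γ t, 0) = 0 := DFunLike.congr_fun hfst (deriv γ t)
    have hadd : ((deriv γ t, 1) : E × ℝ) = (deriv γ t, 0) + (0, 1) := by simp
    rw [hadd, map_add, h0, hsnd, zero_add]
  rw [hsplit] at hcurve
  exact hcurve

/-- Envelope formula: if `(u(ε), v(ε))` is a differentiable curve of critical points of
`(u, v) ↦ Φ(u, v, ε)` on an open interval, then `ε ↦ Φ(u(ε), v(ε), ε)` is differentiable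
there with derivative `−Σ_{r,s} c_{rs}·exp((u_r(ε) + v_s(ε) − ε c_{rs})/η)·μ_r ν_s`. -/
theorem stmt_11
    (η : ℝ) (hη : 0 < η) (N M : ℕ) (hN : 0 < N) (hM : 0 < M)
    (μ : Fin N → ℝ) (ν : Fin M → ℝ) (hμ : ∀ r, 0 < μ r) (hν : ∀ s, 0 < ν s)
    (hμ1 : ∑ r, μ r = 1) (hν1 : ∑ s, ν s = 1)
    (c : Fin N → Fin M → ℝ)
    (Φ : (Fin N → ℝ) → (Fin M → ℝ) → ℝ → ℝ)
    (hΦ : ∀ u v ε, Φ u v ε = -(∑ r, u r * μ r) - (∑ s, v s * ν s)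
      + η * ∑ r, ∑ s, Real.exp ((u r + v s - ε * c r s) / η) * (μ r * ν s))
    (a b : ℝ) (u : ℝ → Fin N → ℝ) (v : ℝ → Fin M → ℝ)
    (hu : ∀ ε ∈ Set.Ioo a b, DifferentiableAt ℝ u ε)
    (hv : ∀ ε ∈ Set.Ioo a b, DifferentiableAt ℝ v ε)
    (hcrit : ∀ ε ∈ Set.Ioo a b,
      fderiv ℝ (fun p : (Fin N → ℝ) × (Fin M → ℝ) => Φ p.1 p.2 ε) (u ε, v ε) = 0) :
    ∀ ε ∈ Set.Ioo a b,
      HasDerivAt (fun t => Φ (u t) (v t) t)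
        (-(∑ r, ∑ s, c r s * Real.exp ((u ε r + v ε s - ε * c r s) / η) * (μ r * ν s))) ε := by
  intro ε hε
  refine hasDerivAt_envelope
    (F := fun (p : (Fin N → ℝ) × (Fin M → ℝ)) t => Φ p.1 p.2 t) (γ := fun t => (u t, v t))
    ?_ ((hu ε hε).prodMk (hv ε hε)) (hcrit ε hε) ?_
  · simp only [hΦ]
    fun_prop
  · simp only [hΦ]
    have hterm (r : Fin N) (s : Fin M) :
        HasDerivAt (fun t => Real.exp ((u ε r + v ε s - t * c r s) / η) * (μ r * ν s))
          (Real.exp ((u ε r + v ε s - ε * c r s) / η) * (-(1 * c r s) / η) * (μ r * ν s)) ε :=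
      (((((hasDerivAt_id ε).mul_const (c r s)).const_sub _).div_const η).exp).mul_const _
    have hsum := HasDerivAt.fun_sum (u := Finset.univ) fun r _ =>
      HasDerivAt.fun_sum (u := Finset.univ) fun s _ => hterm r s
    refine ((hsum.const_mul η).const_add _).congr_deriv ?_
    simp only [Finset.mul_sum, ← Finset.sum_neg_distrib]
    refine Finset.sum_congr rfl fun r _ => Finset.sum_congr rfl fun s _ => ?_
    field_simp
end

section
/- Assume c_ℓ ≥ 0 for all ℓ and that the optimal face V₀ = { v ∈ ℝ^e : A_ℓ·v ≤ c_ℓ for all ℓ, and −b·v = D₀ } of the unregularized dual linear program is nonempty and bounded, where D₀ = inf{ −b·v : A_ℓ·v ≤ c_ℓ for all ℓ }. Let (η_k) be a sequence of positive reals with η_k → 0, and for each k let v_k be a minimizer of v ↦ −b·v + η_k·Σ_{ℓ=1}^m exp((A_ℓ·v − c_ℓ)/η_k)·μ_ℓ. Then the sequence (v_k) is bounded; moreover, if v_k converges to some v₀, then A_ℓ·v₀ ≤ c_ℓ for all ℓ and −b·v₀ = D₀, i.e. v₀ is optimal for the unregularized dual linear program. -/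
open Matrix Filter Topology

/-- A continuous positively homogeneous function that is positive away from the origin of a
finite-dimensional space dominates a positive multiple of the norm. -/
theorem exists_pos_mul_norm_le_of_homogeneous {E : Type*} [NormedAddCommGroup E]
    [NormedSpace ℝ E] [FiniteDimensional ℝ E] [Nontrivial E] {g : E → ℝ} (hg : Continuous g)
    (hsmul : ∀ (r : ℝ) (v : E), 0 ≤ r → g (r • v) = r * g v) (hpos : ∀ v, v ≠ 0 → 0 < g v) :
    ∃ δ > 0, ∀ v, δ * ‖v‖ ≤ g v := by
  have : ProperSpace E := FiniteDimensional.proper ℝ E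
  obtain ⟨d, hd, hmin⟩ := (isCompact_sphere (0 : E) 1).exists_isMinOn
    (NormedSpace.sphere_nonempty.mpr zero_le_one) hg.continuousOn
  have hd0 : d ≠ 0 := by
    rintro rfl
    simp at hd
  refine ⟨g d, hpos d hd0, fun v => ?_⟩
  rcases eq_or_ne v 0 with rfl | hv
  · have := hsmul 0 0 le_rfl
    simp_all
  · have hv' : 0 < ‖v‖ := norm_pos_iff.mpr hv
    have hmem : ‖v‖⁻¹ • v ∈ Metric.sphere (0 : E) 1 := by
      simp [norm_smul, hv'.ne']
    have h : g d ≤ g (‖v‖⁻¹ • v) := hmin hmem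
    rw [hsmul _ _ (by positivity), inv_mul_eq_div, le_div_iff₀ hv'] at h
    exact h

/-- If a polyhedral sublevel set `{v | A v ≤ c, -b·v ≤ D}` is nonempty and bounded, then its
recession cone is trivial. -/
theorem eq_zero_of_mulVec_nonpos_of_bounded {m e : ℕ} {A : Matrix (Fin m) (Fin e) ℝ}
    {b : Fin e → ℝ} {c : Fin m → ℝ} {D M : ℝ} {w : Fin e → ℝ}
    (hw : ∀ ℓ, (A *ᵥ w) ℓ ≤ c ℓ) (hwD : -(b ⬝ᵥ w) ≤ D)
    (hM : ∀ v, (∀ ℓ, (A *ᵥ v) ℓ ≤ c ℓ) → -(b ⬝ᵥ v) ≤ D → ‖v‖ ≤ M)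
    {d : Fin e → ℝ} (hA : ∀ ℓ, (A *ᵥ d) ℓ ≤ 0) (hb : -(b ⬝ᵥ d) ≤ 0) : d = 0 := by
  by_contra hd
  have hd' : 0 < ‖d‖ := norm_pos_iff.mpr hd
  obtain ⟨n, hn⟩ := exists_nat_gt ((M + ‖w‖) / ‖d‖)
  rw [div_lt_iff₀ hd'] at hn
  have hn0 : (0 : ℝ) ≤ n := n.cast_nonneg
  have h := hM (w + (n : ℝ) • d)
    (fun ℓ => by
      simp only [mulVec_add, mulVec_smul, Pi.add_apply, Pi.smul_apply, smul_eq_mul]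
      nlinarith [hw ℓ, hA ℓ])
    (by
      simp only [dotProduct_add, dotProduct_smul, smul_eq_mul]
      nlinarith)
  have h2 : ‖(n : ℝ) • d‖ ≤ ‖w + (n : ℝ) • d‖ + ‖w‖ := by
    simpa using norm_sub_le (w + (n : ℝ) • d) w
  rw [norm_smul, Real.norm_of_nonneg hn0] at h2
  linarith

theorem sq_max_zero_le_mul_exp_div {η : ℝ} (hη : 0 < η) (t : ℝ) :
    max t 0 ^ 2 ≤ 2 * η * (η * Real.exp (t / η)) := by
  rcases le_total t 0 with ht | ht
  · rw [max_eq_right ht, zero_pow two_ne_zero]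
    positivity
  · rw [max_eq_left ht]
    have h := Real.quadratic_le_exp_of_nonneg (div_nonneg ht hη.le)
    have h1 : 0 ≤ t / η := div_nonneg ht hη.le
    calc t ^ 2 = 2 * η * (η * ((t / η) ^ 2 / 2)) := by field_simp
      _ ≤ _ := by gcongr; linarith

/-- A square that grows at most linearly has a square root that grows slower than any linear
function. -/
theorem exists_le_mul_add_of_sq_le {P Q ε : ℝ} (hP : 0 ≤ P) (hQ : 0 ≤ Q) (hε : 0 < ε) :
    ∃ K, ∀ p r : ℝ, 0 ≤ r → p ^ 2 ≤ P * r + Q → p ≤ ε * r + K := by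
  refine ⟨P / (2 * ε) + Q + 1, fun p r hr h => ?_⟩
  have hK : 0 ≤ P / (2 * ε) := by positivity
  have hK' : 2 * ε * (P / (2 * ε)) = P := by field_simp
  refine le_of_sq_le_sq ?_ (by positivity)
  nlinarith [mul_nonneg (mul_nonneg hε.le hr) hQ, mul_nonneg hε.le hr, sq_nonneg (ε * r),
    mul_nonneg hK hQ, sq_nonneg (P / (2 * ε)), sq_nonneg Q]

/-- A value of the regularized objective below `T` bounds the violation of each constraint. -/
theorem mul_sq_violation_le {m e : ℕ} {A : Matrix (Fin m) (Fin e) ℝ} {b : Fin e → ℝ}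
    {c μ : Fin m → ℝ} (hμ : ∀ ℓ, 0 < μ ℓ) {η T : ℝ} (hη : 0 < η) {v : Fin e → ℝ}
    (hT : -(b ⬝ᵥ v) + η * ∑ ℓ, Real.exp (((A *ᵥ v) ℓ - c ℓ) / η) * μ ℓ ≤ T) (ℓ : Fin m) :
    μ ℓ * max ((A *ᵥ v) ℓ - c ℓ) 0 ^ 2 ≤ 2 * η * (T + b ⬝ᵥ v) := by
  have h1 : Real.exp (((A *ᵥ v) ℓ - c ℓ) / η) * μ ℓ ≤
      ∑ i, Real.exp (((A *ᵥ v) i - c i) / η) * μ i :=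
    Finset.single_le_sum (f := fun i => Real.exp (((A *ᵥ v) i - c i) / η) * μ i)
      (fun i _ => mul_nonneg (Real.exp_pos _).le (hμ i).le) (Finset.mem_univ ℓ)
  calc μ ℓ * max ((A *ᵥ v) ℓ - c ℓ) 0 ^ 2
      ≤ μ ℓ * (2 * η * (η * Real.exp (((A *ᵥ v) ℓ - c ℓ) / η))) :=
        mul_le_mul_of_nonneg_left (sq_max_zero_le_mul_exp_div hη _) (hμ ℓ).le
    _ = 2 * η * (η * (Real.exp (((A *ᵥ v) ℓ - c ℓ) / η) * μ ℓ)) := by ring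
    _ ≤ 2 * η * (η * ∑ i, Real.exp (((A *ᵥ v) i - c i) / η) * μ i) := by gcongr
    _ ≤ 2 * η * (T + b ⬝ᵥ v) := by gcongr; linarith

/-- At a feasible point the regularized objective exceeds the linear one by at most
`η * ∑ ℓ, μ ℓ`. -/
theorem regularized_le_of_feasible {m : ℕ} {a c μ : Fin m → ℝ} (hμ : ∀ ℓ, 0 < μ ℓ) {η : ℝ}
    (hη : 0 < η) (ha : ∀ ℓ, a ℓ ≤ c ℓ) :
    η * ∑ ℓ, Real.exp ((a ℓ - c ℓ) / η) * μ ℓ ≤ η * ∑ ℓ, μ ℓ := by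
  gcongr with ℓ
  exact mul_le_of_le_one_left (hμ ℓ).le
    (Real.exp_le_one_iff.mpr (div_nonpos_of_nonpos_of_nonneg (by linarith [ha ℓ]) hη.le))

/-- Points with uniformly bounded regularized objective, for bounded regularization parameters,
are uniformly bounded when the recession cone is trivial. -/
theorem exists_norm_le_of_regularized_le {m e : ℕ} (he : 0 < e) {A : Matrix (Fin m) (Fin e) ℝ}
    {b : Fin e → ℝ} {c μ : Fin m → ℝ} (hμ : ∀ ℓ, 0 < μ ℓ)
    (hrec : ∀ d, (∀ ℓ, (A *ᵥ d) ℓ ≤ 0) → -(b ⬝ᵥ d) ≤ 0 → d = 0) (H T : ℝ) :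
    ∃ R, ∀ (η : ℝ) (v : Fin e → ℝ), 0 < η → η ≤ H →
      -(b ⬝ᵥ v) + η * ∑ ℓ, Real.exp (((A *ᵥ v) ℓ - c ℓ) / η) * μ ℓ ≤ T → ‖v‖ ≤ R := by
  have : Nonempty (Fin e) := ⟨⟨0, he⟩⟩
  obtain ⟨δ, hδ, hg⟩ := exists_pos_mul_norm_le_of_homogeneous
    (g := fun v : Fin e → ℝ => ∑ ℓ, max ((A *ᵥ v) ℓ) 0 + max (-(b ⬝ᵥ v)) 0)
    (by unfold mulVec dotProduct; fun_prop)
    (fun r v hr => by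
      simp only [mulVec_smul, dotProduct_smul, Pi.smul_apply, smul_eq_mul, mul_add,
        Finset.mul_sum, mul_max_of_nonneg _ _ hr, mul_zero, mul_neg])
    (fun v hv => by
      by_contra! h
      have h1 : ∀ ℓ ∈ Finset.univ, 0 ≤ max ((A *ᵥ v) ℓ) 0 := fun ℓ _ => le_max_right _ _
      have h2 : 0 ≤ max (-(b ⬝ᵥ v)) 0 := le_max_right _ _
      have h3 := Finset.sum_nonneg h1
      refine hv (hrec v (fun ℓ => ?_) ?_)
      · have := Finset.single_le_sum h1 (Finset.mem_univ ℓ)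
        linarith [le_max_left ((A *ᵥ v) ℓ) 0]
      · linarith [le_max_left (-(b ⬝ᵥ v)) 0])
  set B : ℝ := ∑ j, |b j| with hB
  have hB0 : 0 ≤ B := Finset.sum_nonneg fun _ _ => abs_nonneg _
  have hbv (v : Fin e → ℝ) : b ⬝ᵥ v ≤ B * ‖v‖ := by
    rw [hB, dotProduct, Finset.sum_mul]
    refine Finset.sum_le_sum fun j _ => (le_abs_self _).trans ?_
    rw [abs_mul]
    exact mul_le_mul_of_nonneg_left (norm_le_pi_norm v j) (abs_nonneg _)
  set ε : ℝ := δ / (2 * (m + 1)) with hε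
  have hε0 : 0 < ε := by positivity
  have hεm : m * ε ≤ δ / 2 := by
    rw [hε, mul_div_assoc', div_le_div_iff₀ (by positivity) two_pos]
    nlinarith
  have hμH (ℓ : Fin m) : 0 ≤ 2 * |H| / μ ℓ := div_nonneg (by positivity) (hμ ℓ).le
  choose K hK using fun ℓ : Fin m => exists_le_mul_add_of_sq_le
    (mul_nonneg (hμH ℓ) hB0) (mul_nonneg (hμH ℓ) (abs_nonneg T)) hε0
  refine ⟨(∑ ℓ, (K ℓ + |c ℓ|) + |T|) / (δ / 2), fun η v hη hηH hT => ?_⟩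
  have hb : max (-(b ⬝ᵥ v)) 0 ≤ |T| := by
    have : 0 ≤ η * ∑ ℓ, Real.exp (((A *ᵥ v) ℓ - c ℓ) / η) * μ ℓ :=
      mul_nonneg hη.le
        (Finset.sum_nonneg fun i _ => mul_nonneg (Real.exp_pos _).le (hμ i).le)
    exact max_le (by linarith [le_abs_self T]) (abs_nonneg T)
  have hA (ℓ : Fin m) : max ((A *ᵥ v) ℓ) 0 ≤ ε * ‖v‖ + (K ℓ + |c ℓ|) := by
    have h := mul_sq_violation_le hμ hη hT ℓ
    have h1 : max ((A *ᵥ v) ℓ - c ℓ) 0 ≤ ε * ‖v‖ + K ℓ := by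
      refine hK ℓ _ _ (norm_nonneg v) ?_
      have h2 : 2 * η * (T + b ⬝ᵥ v) ≤ 2 * |H| * (|T| + B * ‖v‖) := by
        have : 0 ≤ |T| + B * ‖v‖ := by positivity
        calc 2 * η * (T + b ⬝ᵥ v) ≤ 2 * η * (|T| + B * ‖v‖) := by
              gcongr
              exacts [le_abs_self T, hbv v]
          _ ≤ _ := by
              gcongr
              exact hηH.trans (le_abs_self H)
      have h3 : 2 * |H| / μ ℓ * B * ‖v‖ + 2 * |H| / μ ℓ * |T|
          = 2 * |H| * (|T| + B * ‖v‖) / μ ℓ := by ring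
      rw [h3, le_div_iff₀ (hμ ℓ)]
      linarith
    refine max_le ?_ ?_
    · linarith [le_max_left ((A *ᵥ v) ℓ - c ℓ) 0, le_abs_self (c ℓ)]
    · linarith [le_max_right ((A *ᵥ v) ℓ - c ℓ) 0, abs_nonneg (c ℓ)]
  have hsum : ∑ ℓ, max ((A *ᵥ v) ℓ) 0 ≤ m * ε * ‖v‖ + ∑ ℓ, (K ℓ + |c ℓ|) := by
    refine (Finset.sum_le_sum fun ℓ _ => hA ℓ).trans_eq ?_
    rw [Finset.sum_add_distrib, Finset.sum_const, Finset.card_univ, Fintype.card_fin,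
      nsmul_eq_mul, mul_assoc]
  rw [le_div_iff₀ (by positivity)]
  have := hg v
  have := mul_le_mul_of_nonneg_right hεm (norm_nonneg v)
  linarith

/-- Convergence of the regularized dual solutions: if `c ≥ 0`, the optimal face `V₀` of the
unregularized dual LP is nonempty and bounded, `η_k → 0`, and `v_k` minimizes the
entropically regularized dual objective with parameter `η_k`, then `(v_k)` is bounded, and
any limit `v₀` of the sequence is feasible (`A_ℓ·v₀ ≤ c_ℓ` for all `ℓ`) and optimal
(`−b·v₀ = D₀`) for the unregularized dual LP. -/
theorem stmt_14
    (m e : ℕ) (hm : 0 < m) (he : 0 < e)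
    (A : Matrix (Fin m) (Fin e) ℝ) (b : Fin e → ℝ) (c : Fin m → ℝ)
    (μ : Fin m → ℝ) (hμ : ∀ ℓ, 0 < μ ℓ) (hc : ∀ ℓ, 0 ≤ c ℓ)
    (D₀ : ℝ)
    (hD₀ : IsGLB {t : ℝ | ∃ v : Fin e → ℝ,
      (∀ ℓ, ∑ j, A ℓ j * v j ≤ c ℓ) ∧ t = -(∑ j, b j * v j)} D₀)
    (hV₀ne : ∃ v : Fin e → ℝ,
      (∀ ℓ, ∑ j, A ℓ j * v j ≤ c ℓ) ∧ -(∑ j, b j * v j) = D₀)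
    (hV₀bdd : ∃ M₀ : ℝ, ∀ v : Fin e → ℝ,
      (∀ ℓ, ∑ j, A ℓ j * v j ≤ c ℓ) → -(∑ j, b j * v j) = D₀ → ‖v‖ ≤ M₀)
    (η : ℕ → ℝ) (hηpos : ∀ k, 0 < η k)
    (hηlim : Filter.Tendsto η Filter.atTop (nhds 0))
    (v : ℕ → Fin e → ℝ)
    (hvk : ∀ (k : ℕ) (w : Fin e → ℝ),
      -(∑ j, b j * v k j) + η k * ∑ ℓ, Real.exp ((∑ j, A ℓ j * v k j - c ℓ) / η k) * μ ℓ
        ≤ -(∑ j, b j * w j) + η k * ∑ ℓ, Real.exp ((∑ j, A ℓ j * w j - c ℓ) / η k) * μ ℓ) :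
    (∃ R : ℝ, ∀ k, ‖v k‖ ≤ R) ∧
    (∀ v₀ : Fin e → ℝ, Filter.Tendsto v Filter.atTop (nhds v₀) →
      (∀ ℓ, ∑ j, A ℓ j * v₀ j ≤ c ℓ) ∧ -(∑ j, b j * v₀ j) = D₀) := by
  have hfeas : ∀ w : Fin e → ℝ, (∀ ℓ, (A *ᵥ w) ℓ ≤ c ℓ) → D₀ ≤ -(b ⬝ᵥ w) :=
    fun w hw => hD₀.1 ⟨w, hw, rfl⟩
  obtain ⟨w, hw, hwD⟩ := hV₀ne
  obtain ⟨M, hM⟩ := hV₀bdd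
  set S : ℝ := ∑ ℓ, μ ℓ
  have hS0 : 0 ≤ S := Finset.sum_nonneg fun ℓ _ => (hμ ℓ).le
  have hval (k : ℕ) : -(b ⬝ᵥ v k) +
      η k * ∑ ℓ, Real.exp (((A *ᵥ v k) ℓ - c ℓ) / η k) * μ ℓ ≤ D₀ + η k * S :=
    (hvk k w).trans (add_le_add hwD.le (regularized_le_of_feasible hμ (hηpos k) hw))
  constructor
  · obtain ⟨H, hH⟩ := hηlim.bddAbove_range
    have hH' (k : ℕ) : η k ≤ H := hH ⟨k, rfl⟩
    have hrec (d : Fin e → ℝ) (hA : ∀ ℓ, (A *ᵥ d) ℓ ≤ 0) (hb : -(b ⬝ᵥ d) ≤ 0) : d = 0 :=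
      eq_zero_of_mulVec_nonpos_of_bounded (D := D₀) hw hwD.le
        (fun u hu huD => hM u hu (le_antisymm huD (hfeas u hu))) hA hb
    obtain ⟨R, hR⟩ := exists_norm_le_of_regularized_le (c := c) he hμ hrec H (D₀ + H * S)
    refine ⟨R, fun k => hR (η k) (v k) (hηpos k) (hH' k) ((hval k).trans ?_)⟩
    gcongr
    exact hH' k
  · intro v₀ hv
    have hcA (ℓ : Fin m) : Continuous fun u : Fin e → ℝ => (A *ᵥ u) ℓ := by
      unfold mulVec dotProduct
      fun_prop
    have hcb : Continuous fun u : Fin e → ℝ => b ⬝ᵥ u := by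
      unfold dotProduct
      fun_prop
    have hb := (hcb.tendsto v₀).comp hv
    have hT : Tendsto (fun k => D₀ + η k * S) atTop (𝓝 D₀) := by
      simpa using (hηlim.mul_const S).const_add D₀
    have hfeas₀ : ∀ ℓ, (A *ᵥ v₀) ℓ ≤ c ℓ := by
      intro ℓ
      have hl : Tendsto (fun k => μ ℓ * max ((A *ᵥ v k) ℓ - c ℓ) 0 ^ 2) atTop
          (𝓝 (μ ℓ * max ((A *ᵥ v₀) ℓ - c ℓ) 0 ^ 2)) :=
        (((((((hcA ℓ).tendsto v₀).comp hv).sub_const (c ℓ)).max tendsto_const_nhds).pow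
          2).const_mul (μ ℓ))
      have hr : Tendsto (fun k => 2 * η k * (D₀ + η k * S + b ⬝ᵥ v k)) atTop (𝓝 0) := by
        simpa using (hηlim.const_mul 2).mul (hT.add hb)
      have h := le_of_tendsto_of_tendsto' hl hr
        fun k => mul_sq_violation_le hμ (hηpos k) (hval k) ℓ
      have h2 : max ((A *ᵥ v₀) ℓ - c ℓ) 0 ^ 2 ≤ 0 := nonpos_of_mul_nonpos_right h (hμ ℓ)
      have h3 := pow_eq_zero_iff (two_ne_zero) |>.mp (le_antisymm h2 (sq_nonneg _))
      linarith [le_max_left ((A *ᵥ v₀) ℓ - c ℓ) 0]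
    refine ⟨hfeas₀, le_antisymm ?_ (hfeas v₀ hfeas₀)⟩
    refine le_of_tendsto_of_tendsto' hb.neg hT fun k => ?_
    have : 0 ≤ η k * ∑ ℓ, Real.exp (((A *ᵥ v k) ℓ - c ℓ) / η k) * μ ℓ :=
      mul_nonneg (hηpos k).le
        (Finset.sum_nonneg fun i _ => mul_nonneg (Real.exp_pos _).le (hμ i).le)
    exact (le_add_of_nonneg_right this).trans (hval k)
end

section
/- Let f : ℝ^p × ℝ^q → ℝ be continuously differentiable and strongly convex (there is d > 0 such that f − (d/2)‖·‖² is convex on ℝ^p × ℝ^q). Starting from any (x₀, y₀), define recursively x_{k+1} as the unique minimizer of x ↦ f(x, y_k) and y_{k+1} as the unique minimizer of y ↦ f(x_{k+1}, y) (these minimizers exist and are unique by strong convexity). Then the sequence (x_k, y_k) converges to the unique global minimizer of f. (This is the convergence of the block coordinate descent / Sinkhorn iteration applied to the regularized dual objective.) -/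
open Filter Topology

/-- First-order characterization of strong convexity: a differentiable function `f` such that
`f - c * N` is convex, where `N` is a quadratic form with polar form `2 * B`, lies above its
tangents by at least `c * N`. -/
theorem ConvexOn.add_fderiv_add_le_of_sub_quadratic {E : Type*} [NormedAddCommGroup E]
    [NormedSpace ℝ E] {f N : E → ℝ} {B : E → E → ℝ} {c : ℝ}
    (hN : ∀ (z v : E) (t : ℝ), N (z + t • v) = N z + 2 * t * B z v + t ^ 2 * N v)
    (hconv : ConvexOn ℝ Set.univ fun z => f z - c * N z) (hf : Differentiable ℝ f) (z w : E) :
    f z + fderiv ℝ f z (w - z) + c * N (w - z) ≤ f w := by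
  set v := w - z with hv
  have hφ : ConvexOn ℝ Set.univ fun t : ℝ => f (z + t • v) - c * N (z + t • v) := by
    refine ⟨convex_univ, fun s _ t _ a b ha hb hab => ?_⟩
    have h := hconv.2 (Set.mem_univ (z + s • v)) (Set.mem_univ (z + t • v)) ha hb hab
    have e : a • (z + s • v) + b • (z + t • v) = z + (a • s + b • t) • v := by
      calc a • (z + s • v) + b • (z + t • v) = (a + b) • z + (a • s + b • t) • v := by
            simp only [smul_eq_mul]; module
        _ = _ := by rw [hab, one_smul]
    rwa [e] at h
  have hline : HasDerivAt (fun t : ℝ => z + t • v) v 0 := by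
    simpa using ((hasDerivAt_id (0 : ℝ)).smul_const v).const_add z
  have hfd : HasDerivAt (fun t : ℝ => f (z + t • v)) (fderiv ℝ f z v) 0 := by
    have h : HasFDerivAt f (fderiv ℝ f z) (z + (0 : ℝ) • v) := by
      simpa using (hf z).hasFDerivAt
    exact h.comp_hasDerivAt 0 hline
  have hNd : HasDerivAt (fun t : ℝ => N (z + t • v)) (2 * B z v) 0 := by
    simp only [hN]
    have h1 := ((hasDerivAt_id (0 : ℝ)).const_mul 2).mul_const (B z v)
    have h2 := ((hasDerivAt_id (0 : ℝ)).pow 2).mul_const (N v)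
    refine ((h1.const_add (N z)).add h2).congr_deriv ?_
    simp
  have h := hφ.le_slope_of_hasDerivAt (Set.mem_univ 0) (Set.mem_univ 1) one_pos
    (hfd.sub (hNd.const_mul c))
  have h1 := hN z v 1
  have hw : z + v = w := by rw [hv]; abel
  simp only [slope_def_field, one_smul, zero_smul, add_zero, sub_zero, div_one, hw] at h h1
  rw [h1] at h
  linarith

theorem pi_norm_sq_le_sum_sq {ι : Type*} [Fintype ι] (v : ι → ℝ) : ‖v‖ ^ 2 ≤ ∑ i, v i ^ 2 := by
  have hnn : 0 ≤ ∑ i, v i ^ 2 := Finset.sum_nonneg fun i _ => sq_nonneg (v i)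
  refine (Real.le_sqrt (norm_nonneg v) hnn).1 ?_
  refine (pi_norm_le_iff_of_nonneg (Real.sqrt_nonneg _)).2 fun i => Real.le_sqrt_of_sq_le ?_
  rw [Real.norm_eq_abs, sq_abs]
  exact Finset.single_le_sum (f := fun i => v i ^ 2) (fun i _ => sq_nonneg (v i))
    (Finset.mem_univ i)

theorem prod_pi_norm_sq_le_sum_sq {ι κ : Type*} [Fintype ι] [Fintype κ]
    (z : (ι → ℝ) × (κ → ℝ)) : ‖z‖ ^ 2 ≤ (∑ i, z.1 i ^ 2) + (∑ j, z.2 j ^ 2) := by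
  rw [Prod.norm_def]
  have h1 := pi_norm_sq_le_sum_sq z.1
  have h2 := pi_norm_sq_le_sum_sq z.2
  rcases max_choice ‖z.1‖ ‖z.2‖ with h | h <;> rw [h] <;>
    linarith [sq_nonneg ‖z.1‖, sq_nonneg ‖z.2‖]

section UniformlyConvex

variable {E F : Type*} [NormedAddCommGroup E] [NormedSpace ℝ E]
  [NormedAddCommGroup F] [NormedSpace ℝ F] {c : ℝ}

theorem isCompact_sublevel_of_add_fderiv_add_le [ProperSpace E] {f : E → ℝ} (hc : 0 < c)
    (hf : Continuous f) (h : ∀ z w, f z + fderiv ℝ f z (w - z) + c * ‖w - z‖ ^ 2 ≤ f w) (a : ℝ) :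
    IsCompact {w | f w ≤ a} := by
  refine Metric.isCompact_of_isClosed_isBounded (isClosed_le hf continuous_const)
    (isBounded_iff_forall_norm_le.2 ⟨(‖fderiv ℝ f 0‖ + |a - f 0|) / c + 1, fun w hw => ?_⟩)
  have hw : f w ≤ a := hw
  have h0 := h 0 w
  rw [sub_zero] at h0
  have h1 := neg_le_of_abs_le ((fderiv ℝ f 0).le_opNorm w)
  have h2 := le_abs_self (a - f 0)
  by_contra! hlt
  have hM := norm_nonneg (fderiv ℝ f 0)
  have hA := abs_nonneg (a - f 0)
  have h3 : ‖fderiv ℝ f 0‖ + |a - f 0| + c < c * ‖w‖ := by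
    have := mul_lt_mul_of_pos_left hlt hc
    rwa [mul_add, mul_one, mul_div_cancel₀ _ hc.ne'] at this
  have h4 : 1 ≤ ‖w‖ := by
    have : 0 ≤ (‖fderiv ℝ f 0‖ + |a - f 0|) / c := by positivity
    linarith
  nlinarith [mul_le_mul_of_nonneg_left h4 hA]

/-- Convergence of two-block coordinate descent for a `C¹` function that lies quadratically above
its tangents. -/
theorem exists_tendsto_alternating_minimization [ProperSpace E] [ProperSpace F]
    {f : E × F → ℝ} (hc : 0 < c) (hf : ContDiff ℝ 1 f)
    (h : ∀ z w, f z + fderiv ℝ f z (w - z) + c * ‖w - z‖ ^ 2 ≤ f w) {x : ℕ → E} {y : ℕ → F}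
    (hx : ∀ k x', f (x (k + 1), y k) ≤ f (x', y k))
    (hy : ∀ k y', f (x (k + 1), y (k + 1)) ≤ f (x (k + 1), y')) :
    ∃ z, (∀ w, f z ≤ f w) ∧ Tendsto (fun k => (x k, y k)) atTop (𝓝 z) := by
  have hdiff : Differentiable ℝ f := hf.differentiable one_ne_zero
  have hcompact := isCompact_sublevel_of_add_fderiv_add_le hc hf.continuous h
  set u : ℕ → E × F := fun k => (x (k + 1), y k) with hu
  set v : ℕ → E × F := fun k => (x (k + 1), y (k + 1)) with hv
  have hvu : ∀ k, f (v k) ≤ f (u k) := fun k => hy k (y k)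
  have huv : ∀ k, f (u (k + 1)) ≤ f (v k) := fun k => hx (k + 1) (x (k + 1))
  have hanti : Antitone fun k => f (u k) :=
    antitone_nat_of_succ_le fun k => (huv k).trans (hvu k)
  have huK : ∀ k, u k ∈ {w | f w ≤ f (u 0)} := fun k => hanti k.zero_le
  have hvK : ∀ k, v k ∈ {w | f w ≤ f (u 0)} := fun k => (hvu k).trans (huK k)
  obtain ⟨z, hz⟩ : ∃ z, ∀ w, f z ≤ f w := by
    obtain ⟨z, hzK, hz⟩ := (hcompact (f (u 0))).exists_isMinOn ⟨u 0, huK 0⟩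
      hf.continuous.continuousOn
    refine ⟨z, fun w => ?_⟩
    rcases le_total (f w) (f (u 0)) with hw | hw
    · exact hz hw
    · exact hzK.trans hw
  have hux : ∀ k s, fderiv ℝ f (u k) (s, 0) = 0 := fun k s => by
    have hd : HasFDerivAt (fun x' => f (x', y k)) _ (x (k + 1)) :=
      (hdiff (u k)).hasFDerivAt.comp (x (k + 1)) (hasFDerivAt_prodMk_left (x (k + 1)) (y k))
    have hmin : IsLocalMin (fun x' => f (x', y k)) (x (k + 1)) := .of_forall (hx k)
    simpa using DFunLike.congr_fun (hmin.hasFDerivAt_eq_zero hd) s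
  have hvy : ∀ k t, fderiv ℝ f (v k) (0, t) = 0 := fun k t => by
    have hd : HasFDerivAt (fun y' => f (x (k + 1), y')) _ (y (k + 1)) :=
      (hdiff (v k)).hasFDerivAt.comp (y (k + 1))
        (hasFDerivAt_prodMk_right (x (k + 1)) (y (k + 1)))
    have hmin : IsLocalMin (fun y' => f (x (k + 1), y')) (y (k + 1)) := .of_forall (hy k)
    simpa using DFunLike.congr_fun (hmin.hasFDerivAt_eq_zero hd) t
  have hdecr : Tendsto (fun k => f (u k) - f (u (k + 1))) atTop (𝓝 0) := by
    have hl := tendsto_atTop_ciInf hanti ⟨f z, by rintro _ ⟨k, rfl⟩; exact hz _⟩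
    simpa using hl.sub (hl.comp (tendsto_add_atTop_nat 1))
  have hstep : ∀ k, c * dist (u k) (v k) ^ 2 ≤ f (u k) - f (u (k + 1)) := fun k => by
    have h1 := h (v k) (u k)
    have e : u k - v k = (0, y k - y (k + 1)) := by simp [hu, hv]
    rw [dist_eq_norm]
    rw [show fderiv ℝ f (v k) (u k - v k) = 0 by rw [e, hvy]] at h1
    linarith [huv k]
  have hgrad : ∀ k, c * dist (v k) z ≤ dist (fderiv ℝ f (u k)) (fderiv ℝ f (v k)) := fun k => by
    have h1 := h (v k) z
    have e : z - v k = (z.1 - x (k + 1), 0) + (0, z.2 - y (k + 1)) := by ext <;> simp [hv]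
    have e1 : fderiv ℝ f (v k) (z - v k) = fderiv ℝ f (v k) (z.1 - x (k + 1), 0) := by
      rw [e, map_add, hvy, add_zero]
    have h2 := (fderiv ℝ f (u k) - fderiv ℝ f (v k)).le_opNorm (z.1 - x (k + 1), 0)
    rw [sub_apply, hux, zero_sub, ← e1, norm_neg] at h2
    have h3 : ‖((z.1 - x (k + 1), 0) : E × F)‖ ≤ ‖z - v k‖ := by
      rw [Prod.norm_mk, norm_zero, max_eq_left (norm_nonneg _)]
      exact norm_fst_le (z - v k)
    have h4 := neg_le_of_abs_le (h2.trans (mul_le_mul_of_nonneg_left h3 (norm_nonneg _)))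
    rw [dist_comm, dist_eq_norm, dist_eq_norm]
    rcases (norm_nonneg (z - v k)).eq_or_lt with h0 | h0
    · rw [← h0, mul_zero]; exact norm_nonneg _
    · refine le_of_mul_le_mul_right ?_ h0
      linarith [hz (v k)]
  refine ⟨z, hz, (tendsto_add_atTop_iff_nat 1).1 ?_⟩
  have huc := (hcompact (f (u 0))).uniformContinuousOn_of_continuous
    (hf.continuous_fderiv one_ne_zero).continuousOn
  rw [Metric.uniformContinuousOn_iff] at huc
  refine Metric.tendsto_nhds.2 fun ε hε => ?_
  obtain ⟨δ, hδ, hδε⟩ := huc (c * ε) (mul_pos hc hε)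
  filter_upwards [hdecr.eventually_lt_const (mul_pos hc (pow_pos hδ 2))] with k hk
  have hlt : dist (u k) (v k) < δ :=
    lt_of_pow_lt_pow_left₀ 2 hδ.le (lt_of_mul_lt_mul_left ((hstep k).trans_lt hk) hc.le)
  exact lt_of_mul_lt_mul_left
    ((hgrad k).trans_lt (hδε _ (huK k) _ (hvK k) hlt)) hc.le

end UniformlyConvex


/-- Convergence of block coordinate descent (the generalized Sinkhorn iteration): if
`f : ℝ^p × ℝ^q → ℝ` is continuously differentiable and strongly convex, and the sequence
`(x_k, y_k)` is produced by alternating exact minimization in each block, then it converges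
to the unique global minimizer of `f`. -/
theorem stmt_15
    (p q : ℕ) (hp : 0 < p) (hq : 0 < q)
    (f : (Fin p → ℝ) × (Fin q → ℝ) → ℝ)
    (hf : ContDiff ℝ 1 f)
    (d : ℝ) (hd : 0 < d)
    (hconv : ConvexOn ℝ Set.univ
      (fun z : (Fin p → ℝ) × (Fin q → ℝ) =>
        f z - d / 2 * ((∑ i, z.1 i ^ 2) + (∑ j, z.2 j ^ 2))))
    (x : ℕ → Fin p → ℝ) (y : ℕ → Fin q → ℝ)
    (hx : ∀ (k : ℕ) (x' : Fin p → ℝ), f (x (k + 1), y k) ≤ f (x', y k))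
    (hy : ∀ (k : ℕ) (y' : Fin q → ℝ), f (x (k + 1), y (k + 1)) ≤ f (x (k + 1), y')) :
    ∃ z : (Fin p → ℝ) × (Fin q → ℝ), (∀ w, f z ≤ f w) ∧
      Filter.Tendsto (fun k => (x k, y k)) Filter.atTop (nhds z) := by
  have hN : ∀ (z v : (Fin p → ℝ) × (Fin q → ℝ)) (t : ℝ),
      (∑ i, (z + t • v).1 i ^ 2) + (∑ j, (z + t • v).2 j ^ 2) =
        ((∑ i, z.1 i ^ 2) + (∑ j, z.2 j ^ 2)) +
          2 * t * ((∑ i, z.1 i * v.1 i) + (∑ j, z.2 j * v.2 j)) +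
          t ^ 2 * ((∑ i, v.1 i ^ 2) + (∑ j, v.2 j ^ 2)) := by
    intro z v t
    have hblock : ∀ {n : ℕ} (a b : Fin n → ℝ), ∑ i, (a i + t * b i) ^ 2 =
        ∑ i, a i ^ 2 + 2 * t * ∑ i, a i * b i + t ^ 2 * ∑ i, b i ^ 2 := by
      intro n a b
      simp only [Finset.mul_sum, ← Finset.sum_add_distrib]
      exact Finset.sum_congr rfl fun i _ => by ring
    simp only [Prod.fst_add, Prod.snd_add, Prod.smul_fst, Prod.smul_snd, Pi.add_apply,
      Pi.smul_apply, smul_eq_mul, hblock]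
    ring
  refine exists_tendsto_alternating_minimization (half_pos hd) hf (fun z w => ?_) hx hy
  have h := hconv.add_fderiv_add_le_of_sub_quadratic hN (hf.differentiable one_ne_zero) z w
  have hle := mul_le_mul_of_nonneg_left (prod_pi_norm_sq_le_sum_sq (w - z)) (half_pos hd).le
  linarith
end
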